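/- arXiv:1612.04015 — 9 statements merged into one kernel-verified Lean document; each statement's English description precedes it below -/
import Mathlib

section
/- For every real number α ≥ 3 there exists a constant M > 0 such that for all real numbers a, b with a ≥ 0 and a + b ≥ 0 one has |(a+b)^α − a^α − α·a^{α−1}·b − (α(α−1)/2)·a^{α−2}·b²| ≤ M·(|b|^α + a^{α−3}·min(a³, |b|³)). -/
theorem abs_le_mul_of_abs_deriv_le {f f' : ℝ → ℝ} {s : Set ℝ} {C r : ℝ} (hs : Convex ℝ s)
    (h0 : (0 : ℝ) ∈ s) (hf0 : f 0 = 0) (hf : ∀ t, HasDerivAt f (f' t) t)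
    (hC : ∀ t ∈ s, |f' t| ≤ C) (hr : ∀ t ∈ s, |t| ≤ r) : ∀ t ∈ s, |f t| ≤ C * r := by
  intro t ht
  have h := hs.norm_image_sub_le_of_norm_hasDerivWithin_le
    (fun x _ => (hf x).hasDerivWithinAt) hC h0 ht
  simp only [hf0, sub_zero, Real.norm_eq_abs] at h
  exact h.trans (mul_le_mul_of_nonneg_left (hr t ht) ((abs_nonneg _).trans (hC 0 h0)))

theorem hasDerivAt_const_add_rpow (a t : ℝ) {p : ℝ} (hp : 1 ≤ p) :
    HasDerivAt (fun t : ℝ => (a + t) ^ p) (p * (a + t) ^ (p - 1)) t := by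
  simpa using ((hasDerivAt_id t).const_add a).rpow_const (p := p) (Or.inr hp)

theorem abs_rpow_taylor_two_le {α a b : ℝ} (hα : 3 ≤ α) (ha : 0 ≤ a) (hab : 0 ≤ a + b) :
    |(a + b) ^ α - a ^ α - α * a ^ (α - 1) * b - (α * (α - 1) / 2) * a ^ (α - 2) * b ^ 2|
      ≤ α * (α - 1) * (α - 2) * ((a + |b|) ^ (α - 3) * |b| ^ 3) := by
  set s : Set ℝ := Set.Icc (max (-a) (-|b|)) |b| with hs_def
  have hs : Convex ℝ s := convex_Icc _ _
  have mem_s : ∀ {t}, t ∈ s ↔ 0 ≤ a + t ∧ |t| ≤ |b| := by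
    intro t
    rw [hs_def, Set.mem_Icc, max_le_iff, abs_le (a := t), and_assoc, neg_le_iff_add_nonneg']
  have h0 : (0 : ℝ) ∈ s := mem_s.2 (by simpa using ha)
  have hr : ∀ t ∈ s, |t| ≤ |b| := fun t ht => (mem_s.1 ht).2
  have h3 : ∀ t ∈ s, |(α - 2) * (a + t) ^ (α - 3)| ≤ (α - 2) * (a + |b|) ^ (α - 3) := by
    intro t ht
    obtain ⟨h1, h2⟩ := mem_s.1 ht
    rw [abs_of_nonneg (mul_nonneg (by linarith) (Real.rpow_nonneg h1 _))]
    exact mul_le_mul_of_nonneg_left (Real.rpow_le_rpow h1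
      (by linarith [le_abs_self t]) (by linarith)) (by linarith)
  have h2 := abs_le_mul_of_abs_deriv_le (f := fun t => (a + t) ^ (α - 2) - a ^ (α - 2)) hs h0
    (by simp) (fun t => by
      refine ((hasDerivAt_const_add_rpow a t (p := α - 2) (by linarith)).sub_const _).congr_deriv ?_
      rw [show α - 2 - 1 = α - 3 by ring]) h3 hr
  have h1 := abs_le_mul_of_abs_deriv_le
    (f := fun t => (a + t) ^ (α - 1) - a ^ (α - 1) - (α - 1) * a ^ (α - 2) * t)
    (f' := fun t => (α - 1) * ((a + t) ^ (α - 2) - a ^ (α - 2))) hs h0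
    (by simp) (fun t => by
      refine (((hasDerivAt_const_add_rpow a t (p := α - 1) (by linarith)).sub_const _).sub
        ((hasDerivAt_id t).const_mul ((α - 1) * a ^ (α - 2)))).congr_deriv ?_
      rw [show α - 1 - 1 = α - 2 by ring]
      ring)
    (fun t ht => by
      rw [abs_mul, abs_of_nonneg (show 0 ≤ α - 1 by linarith)]
      exact mul_le_mul_of_nonneg_left (h2 t ht) (by linarith)) hr
  have h := abs_le_mul_of_abs_deriv_le
    (f := fun t => (a + t) ^ α - a ^ α - α * a ^ (α - 1) * t
      - (α * (α - 1) / 2) * a ^ (α - 2) * t ^ 2)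
    (f' := fun t => α * ((a + t) ^ (α - 1) - a ^ (α - 1) - (α - 1) * a ^ (α - 2) * t)) hs h0
    (by simp) (fun t => by
      refine ((((hasDerivAt_const_add_rpow a t (p := α) (by linarith)).sub_const _).sub
        ((hasDerivAt_id t).const_mul (α * a ^ (α - 1)))).sub
        ((hasDerivAt_pow 2 t).const_mul ((α * (α - 1) / 2) * a ^ (α - 2)))).congr_deriv ?_
      push_cast
      ring)
    (fun t ht => by
      rw [abs_mul, abs_of_nonneg (show 0 ≤ α by linarith)]
      exact mul_le_mul_of_nonneg_left (h1 t ht) (by linarith)) hr b (mem_s.2 ⟨hab, le_rfl⟩)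
  exact h.trans_eq (by ring)

theorem add_rpow_mul_pow_three_le {p a c : ℝ} (hp : 0 ≤ p) (ha : 0 ≤ a) (hc : 0 ≤ c) :
    (a + c) ^ p * c ^ 3 ≤ 2 ^ p * (c ^ (p + 3) + a ^ p * min (a ^ 3) (c ^ 3)) := by
  rcases le_total c a with h | h
  · have hcp : 0 ≤ c ^ (p + 3) := Real.rpow_nonneg hc _
    rw [min_eq_right (pow_le_pow_left₀ hc h 3)]
    calc (a + c) ^ p * c ^ 3 ≤ (2 * a) ^ p * c ^ 3 := by
          gcongr
          linarith
      _ = 2 ^ p * (a ^ p * c ^ 3) := by rw [Real.mul_rpow zero_le_two ha, mul_assoc]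
      _ ≤ _ := by
          gcongr
          linarith
  · have hm : 0 ≤ a ^ p * min (a ^ 3) (c ^ 3) := by positivity
    calc (a + c) ^ p * c ^ 3 ≤ (2 * c) ^ p * c ^ 3 := by
          gcongr
          linarith
      _ = 2 ^ p * c ^ (p + 3) := by
          rw [Real.mul_rpow zero_le_two hc, mul_assoc,
            Real.rpow_add_of_nonneg hc hp (by norm_num)]
          norm_cast
      _ ≤ _ := by
          gcongr
          linarith

/-- Lemma 6.1: second-order expansion inequality for real powers. -/
theorem rpow_second_order_expansion (α : ℝ) (hα : 3 ≤ α) :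
    ∃ M : ℝ, 0 < M ∧ ∀ a b : ℝ, 0 ≤ a → 0 ≤ a + b →
      |(a + b) ^ α - a ^ α - α * a ^ (α - 1) * b
          - (α * (α - 1) / 2) * a ^ (α - 2) * b ^ 2|
        ≤ M * (|b| ^ α + a ^ (α - 3) * min (a ^ 3) (|b| ^ 3)) := by
  have hK : 0 < α * (α - 1) * (α - 2) :=
    mul_pos (mul_pos (by linarith) (by linarith)) (by linarith)
  refine ⟨α * (α - 1) * (α - 2) * 2 ^ (α - 3), by positivity, fun a b ha hab => ?_⟩
  have h := add_rpow_mul_pow_three_le (p := α - 3) (by linarith) ha (abs_nonneg b)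
  rw [sub_add_cancel] at h
  rw [mul_assoc _ ((2 : ℝ) ^ (α - 3))]
  exact (abs_rpow_taylor_two_le hα ha hab).trans (mul_le_mul_of_nonneg_left h hK.le)
end

section
/- For every real number α ≥ 1 there exists a constant M > 0 such that for all real numbers a, b with a > 0 and a + b > 0 one has |(a+b)^α − a^α − α·a^{α−1}·b| ≤ M·(|b|^α + a^{α−2}·min(a², b²)). -/
/-- Near `1`, a real power differs from `1` by at most a multiple of the distance to `1`. -/
theorem exists_abs_one_add_rpow_sub_one_le (β : ℝ) :
    ∃ C δ : ℝ, 0 < C ∧ 0 < δ ∧ δ ≤ 1 ∧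
      ∀ t : ℝ, |t| < δ → |(1 + t) ^ β - 1| ≤ C * |t| := by
  have hd : HasDerivAt (fun x : ℝ => x ^ β) (β * 1 ^ (β - 1)) 1 :=
    Real.hasDerivAt_rpow_const (Or.inl one_ne_zero)
  obtain ⟨C, hC, h⟩ := hd.differentiableAt.isBigO_sub.exists_pos
  obtain ⟨ε, hε, h⟩ := Metric.eventually_nhds_iff.1 h.bound
  refine ⟨C, min ε 1, hC, by positivity, min_le_right _ _, fun t ht => ?_⟩
  have := @h (1 + t) (by simpa [Real.dist_eq] using ht.trans_le (min_le_left _ _))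
  simpa using this

/-- The tangent line inequality for a convex power, with the tangent taken at `1 + t`. -/
theorem one_add_rpow_sub_one_le {α t : ℝ} (hα : 1 ≤ α) (ht : 0 < 1 + t) :
    (1 + t) ^ α - 1 ≤ α * t * (1 + t) ^ (α - 1) := by
  have e : 1 + -(t / (1 + t)) = (1 + t)⁻¹ := by field_simp; ring
  have hs : -1 ≤ -(t / (1 + t)) := by
    have : 0 < (1 + t)⁻¹ := by positivity
    linarith
  have h := one_add_mul_self_le_rpow_one_add hs hα
  rw [e, Real.inv_rpow ht.le] at h
  have hp : 0 < (1 + t) ^ α := by positivity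
  have h' := mul_le_mul_of_nonneg_left h hp.le
  rw [mul_inv_cancel₀ hp.ne'] at h'
  rw [Real.rpow_sub_one ht.ne']
  have : (1 + t) ^ α * (1 + α * -(t / (1 + t))) =
      (1 + t) ^ α - α * t * ((1 + t) ^ α / (1 + t)) := by ring
  linarith

/-- First-order expansion of a real power at `1`, uniformly over the half-line. -/
theorem exists_abs_one_add_rpow_sub_le (α : ℝ) (hα : 1 ≤ α) :
    ∃ M : ℝ, 0 < M ∧ ∀ t : ℝ, 0 < 1 + t →
      |(1 + t) ^ α - 1 - α * t| ≤ M * (|t| ^ α + min 1 (t ^ 2)) := by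
  obtain ⟨C, δ, hC, hδ, hδ1, h⟩ := exists_abs_one_add_rpow_sub_one_le (α - 1)
  have hα0 : 0 < α := by linarith
  set K : ℝ := (2 ^ α + 1 + α) / δ ^ α with hK
  have hK0 : 0 < K := by positivity
  refine ⟨α * C + K, by positivity, fun t ht => ?_⟩
  have hm : 0 ≤ min 1 (t ^ 2) := by positivity
  have hp : 0 ≤ |t| ^ α := by positivity
  rcases lt_or_ge |t| δ with htδ | htδ
  · have hlow := one_add_mul_self_le_rpow_one_add (s := t) (by linarith) hα
    have hup := one_add_rpow_sub_one_le hα ht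
    have hmin : min 1 (t ^ 2) = t ^ 2 :=
      min_eq_right ((sq_le_one_iff_abs_le_one t).2 (htδ.le.trans hδ1))
    have hprod : t * ((1 + t) ^ (α - 1) - 1) ≤ C * t ^ 2 :=
      calc t * ((1 + t) ^ (α - 1) - 1) ≤ |t| * |(1 + t) ^ (α - 1) - 1| := by
            rw [← abs_mul]; exact le_abs_self _
        _ ≤ |t| * (C * |t|) := by gcongr; exact h t htδ
        _ = C * t ^ 2 := by rw [← sq_abs t]; ring
    rw [hmin] at hm ⊢
    rw [abs_of_nonneg (by linarith)]
    calc (1 + t) ^ α - 1 - α * t ≤ α * (t * ((1 + t) ^ (α - 1) - 1)) := by linarith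
      _ ≤ α * (C * t ^ 2) := by gcongr
      _ = α * C * t ^ 2 := by ring
      _ ≤ (α * C + K) * (|t| ^ α + t ^ 2) := by
        gcongr <;> linarith
  · set u : ℝ := |t| / δ with hu
    have hu1 : 1 ≤ u := (one_le_div hδ).2 htδ
    have htu : |t| ≤ u := le_div_self (abs_nonneg t) hδ hδ1
    have h1 : 1 ≤ u ^ α := Real.one_le_rpow hu1 hα0.le
    have h2 : u ≤ u ^ α := Real.self_le_rpow_of_one_le hu1 hα
    have h3 : (1 + t) ^ α ≤ 2 ^ α * u ^ α := by
      rw [← Real.mul_rpow (by norm_num) (by linarith)]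
      exact Real.rpow_le_rpow ht.le (by linarith [le_abs_self t]) hα0.le
    have h4 : 0 ≤ (1 + t) ^ α := by positivity
    have h5 : |α * t| ≤ α * u ^ α := by
      rw [abs_mul, abs_of_pos hα0]; gcongr; exact htu.trans h2
    calc |(1 + t) ^ α - 1 - α * t| ≤ (2 ^ α + 1 + α) * u ^ α := by
          have := abs_le.1 h5
          have : 0 ≤ (2 : ℝ) ^ α * u ^ α := by positivity
          rw [abs_le]; constructor <;> linarith
      _ = K * |t| ^ α := by
        rw [hu, Real.div_rpow (abs_nonneg t) hδ.le, hK]; ring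
      _ ≤ (α * C + K) * (|t| ^ α + min 1 (t ^ 2)) := by
        have : 0 < α * C := by positivity
        gcongr <;> linarith

/-- Lemma 6.2: first-order expansion inequality for real powers. -/
theorem rpow_first_order_expansion (α : ℝ) (hα : 1 ≤ α) :
    ∃ M : ℝ, 0 < M ∧ ∀ a b : ℝ, 0 < a → 0 < a + b →
      |(a + b) ^ α - a ^ α - α * a ^ (α - 1) * b|
        ≤ M * (|b| ^ α + a ^ (α - 2) * min (a ^ 2) (b ^ 2)) := by
  obtain ⟨M, hM, h⟩ := exists_abs_one_add_rpow_sub_le α hα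
  refine ⟨M, hM, fun a b ha hab => ?_⟩
  obtain ⟨t, rfl⟩ : ∃ t, b = a * t := ⟨b / a, by field_simp⟩
  have ht : 0 < 1 + t := by
    rw [← mul_one_add] at hab
    exact pos_of_mul_pos_right hab ha.le
  have hp : 0 < a ^ α := by positivity
  have e1 : (a + a * t) ^ α - a ^ α - α * a ^ (α - 1) * (a * t) =
      a ^ α * ((1 + t) ^ α - 1 - α * t) := by
    rw [← mul_one_add, Real.mul_rpow ha.le ht.le, Real.rpow_sub_one ha.ne']
    field_simp
  have e2 : |a * t| ^ α + a ^ (α - 2) * min (a ^ 2) ((a * t) ^ 2) =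
      a ^ α * (|t| ^ α + min 1 (t ^ 2)) := by
    have hmin : min (a ^ 2) ((a * t) ^ 2) = a ^ 2 * min 1 (t ^ 2) := by
      rw [mul_min_of_nonneg _ _ (sq_nonneg a), mul_one, mul_pow]
    rw [hmin, abs_mul, abs_of_pos ha, Real.mul_rpow ha.le (abs_nonneg t),
      Real.rpow_sub ha, Real.rpow_two]
    field_simp
  rw [e1, e2, abs_mul, abs_of_pos hp, mul_left_comm]
  exact mul_le_mul_of_nonneg_left (h t ht) hp.le
end

section
/- For every real number α ≥ 1 and every positive integer p there exists a constant M > 0 such that for all nonnegative real numbers a₁, …, a_p one has |(a₁ + ⋯ + a_p)^α − Σ_{i=1}^p a_i^α| ≤ M·Σ_{i≠j} a_i^{α−1}·min(a_i, a_j), the sum running over ordered pairs (i,j) with i ≠ j. -/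
open Finset

/-- The tangent line bound for the convex function `x ↦ x ^ α`, taken at the larger point. -/
lemma rpow_sub_rpow_le_mul_sub {α x y : ℝ} (hα : 1 ≤ α) (hx : 0 ≤ x) (hxy : x ≤ y) :
    y ^ α - x ^ α ≤ α * y ^ (α - 1) * (y - x) := by
  rcases (hx.trans hxy).eq_or_lt with hy | hy
  · obtain rfl : x = y := le_antisymm hxy (hy ▸ hx)
    simp
  · have hbern := one_add_mul_self_le_rpow_one_add (s := x / y - 1)
      (by linarith [div_nonneg hx hy.le]) hα
    rw [add_sub_cancel, Real.div_rpow hx hy.le, le_div_iff₀ (Real.rpow_pos_of_pos hy α)] at hbern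
    have hpow : y ^ α = y ^ (α - 1) * y := by
      rw [← Real.rpow_add_one hy.ne', sub_add_cancel]
    have hexp : (1 + α * (x / y - 1)) * y ^ α = y ^ α - α * y ^ (α - 1) * (y - x) := by
      rw [hpow]
      field_simp
      ring
    linarith

/-- Comparison of both `(∑ a i) ^ α - a m ^ α` and `∑ i ≠ m, a i ^ α` with the terms coming from
an index `m` at which `a` is maximal. -/
lemma abs_rpow_sum_sub_le_of_forall_le {ι : Type*} [Fintype ι] [DecidableEq ι] {α : ℝ}
    (hα : 1 ≤ α) {a : ι → ℝ} (ha : ∀ i, 0 ≤ a i) {m : ι} (hm : ∀ i, a i ≤ a m) :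
    |(∑ i, a i) ^ α - ∑ i, a i ^ α| ≤
      (α * (Fintype.card ι : ℝ) ^ (α - 1) + 1) *
        (a m ^ (α - 1) * ∑ i ∈ univ.erase m, a i) := by
  have hα0 : 0 ≤ α - 1 := sub_nonneg.2 hα
  have hsum : ∑ i, a i = a m + ∑ i ∈ univ.erase m, a i :=
    (add_sum_erase univ a (mem_univ m)).symm
  have hsum_pow : ∑ i, a i ^ α = a m ^ α + ∑ i ∈ univ.erase m, a i ^ α :=
    (add_sum_erase univ (fun i => a i ^ α) (mem_univ m)).symm
  have hT : 0 ≤ ∑ i ∈ univ.erase m, a i := sum_nonneg fun i _ => ha i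
  have hle : a m ≤ ∑ i, a i := by linarith
  have hcard : ∑ i, a i ≤ Fintype.card ι * a m := by
    simpa using sum_le_card_nsmul univ a (a m) fun i _ => hm i
  have hothers : ∑ i ∈ univ.erase m, a i ^ α ≤ a m ^ (α - 1) * ∑ i ∈ univ.erase m, a i := by
    rw [mul_sum]
    refine sum_le_sum fun i _ => ?_
    calc a i ^ α = a i ^ (α - 1) * a i := by
          rw [← Real.rpow_add_one' (ha i) (by linarith), sub_add_cancel]
      _ ≤ a m ^ (α - 1) * a i :=
          mul_le_mul_of_nonneg_right (Real.rpow_le_rpow (ha i) (hm i) hα0) (ha i)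
  have hothers0 : 0 ≤ ∑ i ∈ univ.erase m, a i ^ α :=
    sum_nonneg fun i _ => Real.rpow_nonneg (ha i) α
  have hmax : (∑ i, a i) ^ α - a m ^ α ≤
      α * (Fintype.card ι : ℝ) ^ (α - 1) * (a m ^ (α - 1) * ∑ i ∈ univ.erase m, a i) := by
    calc (∑ i, a i) ^ α - a m ^ α
        ≤ α * (∑ i, a i) ^ (α - 1) * (∑ i, a i - a m) :=
          rpow_sub_rpow_le_mul_sub hα (ha m) hle
      _ = α * (∑ i, a i) ^ (α - 1) * ∑ i ∈ univ.erase m, a i := by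
          rw [hsum, add_sub_cancel_left]
      _ ≤ α * (Fintype.card ι * a m) ^ (α - 1) * ∑ i ∈ univ.erase m, a i := by
          have := Real.rpow_le_rpow ((ha m).trans hle) hcard hα0
          gcongr
      _ = _ := by
          rw [Real.mul_rpow (Nat.cast_nonneg _) (ha m)]
          ring
  have hmono : a m ^ α ≤ (∑ i, a i) ^ α := Real.rpow_le_rpow (ha m) hle (by linarith)
  have hX := hothers0.trans hothers
  have hCX : 0 ≤ α * (Fintype.card ι : ℝ) ^ (α - 1) *
      (a m ^ (α - 1) * ∑ i ∈ univ.erase m, a i) := by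
    linarith
  rw [hsum_pow, add_mul, one_mul, abs_le]
  constructor <;> linarith

/-- Lemma 6.3: expansion of a power of a finite sum of nonnegative reals. -/
theorem rpow_sum_expansion (α : ℝ) (hα : 1 ≤ α) (p : ℕ) (hp : 0 < p) :
    ∃ M : ℝ, 0 < M ∧ ∀ a : Fin p → ℝ, (∀ i, 0 ≤ a i) →
      |(∑ i, a i) ^ α - ∑ i, a i ^ α|
        ≤ M * ∑ i, ∑ j ∈ Finset.univ.filter (fun j => j ≠ i),
            a i ^ (α - 1) * min (a i) (a j) := by
  have hM : 0 < α * (Fintype.card (Fin p) : ℝ) ^ (α - 1) + 1 := by positivity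
  refine ⟨_, hM, fun a ha => ?_⟩
  have : Nonempty (Fin p) := ⟨⟨0, hp⟩⟩
  obtain ⟨m, hm⟩ := Finite.exists_max a
  refine (abs_rpow_sum_sub_le_of_forall_le hα ha hm).trans
    (mul_le_mul_of_nonneg_left ?_ hM.le)
  calc a m ^ (α - 1) * ∑ j ∈ univ.erase m, a j
      = ∑ j ∈ univ.filter (fun j => j ≠ m), a m ^ (α - 1) * min (a m) (a j) := by
        simp only [filter_ne', mul_sum, min_eq_right (hm _)]
    _ ≤ _ := single_le_sum
        (f := fun i => ∑ j ∈ univ.filter (fun j => j ≠ i), a i ^ (α - 1) * min (a i) (a j))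
        (fun i _ => sum_nonneg fun j _ =>
          mul_nonneg (Real.rpow_nonneg (ha i) _) (le_min (ha i) (ha j)))
        (mem_univ m)
end

section
/- For every real number α ≥ 2 and every positive integer p there exists a constant M > 0 such that for all positive real numbers a₁, …, a_p one has |(a₁ + ⋯ + a_p)^α − Σ_{i=1}^p a_i^α − α·Σ_{i≠j} a_i^{α−1}·a_j| ≤ M·( Σ_{i≠j} max(a_i,a_j)^{α−2}·min(a_i,a_j)² + Σ_{i≠j} min(a_i,a_j)^{α−1}·max(a_i,a_j) ), all sums running over ordered pairs (i,j) with i ≠ j. -/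
open Finset

/-- The tangent line of `x ↦ x ^ β` at `y` lies below the graph. -/
theorem rpow_add_mul_sub_le_rpow {β x y : ℝ} (hβ : 1 ≤ β) (hx : 0 < x) (hy : 0 < y) :
    y ^ β + β * y ^ (β - 1) * (x - y) ≤ x ^ β := by
  have h := one_add_mul_self_le_rpow_one_add
    (s := x / y - 1) (by linarith [div_pos hx hy]) hβ
  rw [add_sub_cancel, Real.div_rpow hx.le hy.le, le_div_iff₀ (Real.rpow_pos_of_pos hy β)] at h
  have hpow : y ^ β = y ^ (β - 1) * y := by
    rw [← Real.rpow_add_one hy.ne', sub_add_cancel]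
  calc y ^ β + β * y ^ (β - 1) * (x - y) = (1 + β * (x / y - 1)) * y ^ β := by
        rw [hpow]
        field_simp
    _ ≤ x ^ β := h

/-- Second-order remainder bound for `y ↦ y ^ α` around `x`. -/
theorem rpow_sub_rpow_sub_le {α x y : ℝ} (hα : 2 ≤ α) (hx : 0 < x) (hxy : x ≤ y) :
    y ^ α - x ^ α - α * x ^ (α - 1) * (y - x) ≤ α * (α - 1) * y ^ (α - 2) * (y - x) ^ 2 := by
  have hy : 0 < y := hx.trans_le hxy
  have h₁ := rpow_add_mul_sub_le_rpow (by linarith : 1 ≤ α) hx hy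
  have h₂ := rpow_add_mul_sub_le_rpow (by linarith : 1 ≤ α - 1) hx hy
  rw [show α - 1 - 1 = α - 2 by ring] at h₂
  have h₃ := mul_le_mul_of_nonneg_left h₂
    (mul_nonneg (by linarith : 0 ≤ α) (sub_nonneg.2 hxy))
  linarith

/-- Lemma 6.4: second-order expansion of a power of a finite sum of positive reals. -/
theorem rpow_sum_expansion_second_order (α : ℝ) (hα : 2 ≤ α) (p : ℕ) (hp : 0 < p) :
    ∃ M : ℝ, 0 < M ∧ ∀ a : Fin p → ℝ, (∀ i, 0 < a i) →
      |(∑ i, a i) ^ α - ∑ i, a i ^ α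
          - α * ∑ i, ∑ j ∈ Finset.univ.filter (fun j => j ≠ i), a i ^ (α - 1) * a j|
        ≤ M * ((∑ i, ∑ j ∈ Finset.univ.filter (fun j => j ≠ i),
                  max (a i) (a j) ^ (α - 2) * min (a i) (a j) ^ 2)
             + ∑ i, ∑ j ∈ Finset.univ.filter (fun j => j ≠ i),
                  min (a i) (a j) ^ (α - 1) * max (a i) (a j)) := by
  have hα₁ : 0 ≤ α - 1 := by linarith
  have hα₀ : 0 ≤ α := by linarith
  refine ⟨α * (α - 1) * (p : ℝ) ^ (α - 2) * p + 1 + α * p, by positivity, fun a ha => ?_⟩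
  have : Nonempty (Fin p) := ⟨⟨0, hp⟩⟩
  obtain ⟨m, hm⟩ := Finite.exists_max a
  have hsplit (f : Fin p → ℝ) : ∑ i, f i = f m + ∑ i ∈ univ.filter (fun j => j ≠ m), f i := by
    rw [filter_ne', add_sum_erase _ _ (mem_univ m)]
  have hsum_le (s : Finset (Fin p)) : ∑ i ∈ s, a i ≤ p * a m :=
    calc ∑ i ∈ s, a i ≤ ∑ i, a i :=
          sum_le_sum_of_subset_of_nonneg (subset_univ s) fun i _ _ => (ha i).le
      _ ≤ p * a m := by
          simpa using sum_le_card_nsmul univ a (a m) fun i _ => hm i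
  have hrow (f : Fin p → Fin p → ℝ) (hf : ∀ i j, 0 ≤ f i j) :
      ∑ j ∈ univ.filter (fun j => j ≠ m), f m j
        ≤ ∑ i, ∑ j ∈ univ.filter (fun j => j ≠ i), f i j :=
    single_le_sum (f := fun i => ∑ j ∈ univ.filter (fun j => j ≠ i), f i j)
      (fun i _ => sum_nonneg fun j _ => hf i j) (mem_univ m)
  have hmin (i j : Fin p) : 0 < min (a i) (a j) := lt_min (ha i) (ha j)
  have hmax (i j : Fin p) : 0 < max (a i) (a j) := (ha i).trans_le (le_max_left _ _)
  have hQ := hrow (fun i j => max (a i) (a j) ^ (α - 2) * min (a i) (a j) ^ 2) fun i j =>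
    mul_nonneg (Real.rpow_nonneg (hmax i j).le _) (sq_nonneg _)
  have hR := hrow (fun i j => min (a i) (a j) ^ (α - 1) * max (a i) (a j)) fun i j =>
    mul_nonneg (Real.rpow_nonneg (hmin i j).le _) (hmax i j).le
  simp only [max_eq_left (hm _), min_eq_right (hm _), ← mul_sum, ← sum_mul] at hQ hR
  set V := ∑ i, ∑ j ∈ univ.filter (fun j => j ≠ i), max (a i) (a j) ^ (α - 2) * min (a i) (a j) ^ 2
  set W := ∑ i, ∑ j ∈ univ.filter (fun j => j ≠ i), min (a i) (a j) ^ (α - 1) * max (a i) (a j)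
  have hpow : ∑ i ∈ univ.filter (fun j => j ≠ m), a i ^ α
      ≤ a m ^ (α - 2) * ∑ i ∈ univ.filter (fun j => j ≠ m), a i ^ 2 := by
    rw [mul_sum]
    refine sum_le_sum fun i _ => ?_
    calc a i ^ α = a i ^ (α - 2) * a i ^ 2 := by
          rw [← Real.rpow_natCast, ← Real.rpow_add (ha i)]
          norm_num
      _ ≤ a m ^ (α - 2) * a i ^ 2 := by
          gcongr
          · exact (ha i).le
          · exact hm i
  have hcross : ∑ i ∈ univ.filter (fun j => j ≠ m), ∑ j ∈ univ.filter (fun j => j ≠ i),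
      a i ^ (α - 1) * a j
        ≤ p * ((∑ i ∈ univ.filter (fun j => j ≠ m), a i ^ (α - 1)) * a m) := by
    rw [mul_left_comm, sum_mul]
    refine sum_le_sum fun i _ => ?_
    rw [← mul_sum]
    exact mul_le_mul_of_nonneg_left (hsum_le _) (Real.rpow_nonneg (ha i).le _)
  have hpow₀ : 0 ≤ ∑ i ∈ univ.filter (fun j => j ≠ m), a i ^ α :=
    sum_nonneg fun i _ => Real.rpow_nonneg (ha i).le _
  have hcross₀ : 0 ≤ ∑ i ∈ univ.filter (fun j => j ≠ m), ∑ j ∈ univ.filter (fun j => j ≠ i),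
      a i ^ (α - 1) * a j :=
    sum_nonneg fun i _ => sum_nonneg fun j _ =>
      mul_nonneg (Real.rpow_nonneg (ha i).le _) (ha j).le
  have hsq : (∑ i ∈ univ.filter (fun j => j ≠ m), a i) ^ 2
      ≤ p * ∑ i ∈ univ.filter (fun j => j ≠ m), a i ^ 2 := by
    refine sq_sum_le_card_mul_sum_sq.trans ?_
    refine mul_le_mul_of_nonneg_right ?_ (sum_nonneg fun i _ => sq_nonneg _)
    exact_mod_cast (card_le_univ _).trans (Fintype.card_fin p).le
  have hrest₀ : 0 ≤ ∑ i ∈ univ.filter (fun j => j ≠ m), a i := sum_nonneg fun i _ => (ha i).le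
  have htotal := hsum_le univ
  rw [hsplit a] at htotal ⊢
  rw [hsplit fun i => a i ^ α,
    hsplit fun i => ∑ j ∈ univ.filter (fun j => j ≠ i), a i ^ (α - 1) * a j, ← mul_sum]
  set S := ∑ i ∈ univ.filter (fun j => j ≠ m), a i
  set S₂ := ∑ i ∈ univ.filter (fun j => j ≠ m), a i ^ 2
  have hrem := rpow_sub_rpow_sub_le hα (ha m) (le_add_of_nonneg_right hrest₀)
  have hrem₀ := rpow_add_mul_sub_le_rpow (by linarith : 1 ≤ α)
    (add_pos_of_pos_of_nonneg (ha m) hrest₀) (ha m)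
  rw [add_sub_cancel_left] at hrem hrem₀
  have hrem_le : α * (α - 1) * (a m + S) ^ (α - 2) * S ^ 2
      ≤ α * (α - 1) * (p : ℝ) ^ (α - 2) * p * (a m ^ (α - 2) * S₂) :=
    calc α * (α - 1) * (a m + S) ^ (α - 2) * S ^ 2
        ≤ α * (α - 1) * (p * a m) ^ (α - 2) * (p * S₂) := by
          have := (ha m).le
          gcongr
      _ = _ := by
          rw [Real.mul_rpow p.cast_nonneg (ha m).le]
          ring
  have hV : 0 ≤ V := (mul_nonneg (Real.rpow_nonneg (ha m).le _)
    (sum_nonneg fun i _ => sq_nonneg _)).trans hQ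
  have hW : 0 ≤ W := (mul_nonneg (sum_nonneg fun i _ => Real.rpow_nonneg (ha i).le _)
    (ha m).le).trans hR
  have hCp : 0 ≤ α * (α - 1) * (p : ℝ) ^ (α - 2) * p := by positivity
  have hαp : 0 ≤ α * p := by positivity
  have hQ' := mul_le_mul_of_nonneg_left hQ hCp
  have hcross' := mul_le_mul_of_nonneg_left hcross hα₀
  have hcross₀' := mul_nonneg hα₀ hcross₀
  have hR' := mul_le_mul_of_nonneg_left hR hαp
  have hCV := mul_nonneg hCp hV
  have hCW := mul_nonneg hCp hW
  have hαV := mul_nonneg hαp hV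
  have hαW := mul_nonneg hαp hW
  rw [abs_le]
  constructor <;> linarith
end

section
/- For every real number α ≥ 2 and every positive integer p there exists a constant M > 0 such that for all positive real numbers a₁, …, a_p and every index i₀ ∈ {1,…,p} one has |(a₁ + ⋯ + a_p)^α − Σ_{i=1}^p a_i^α − α·a_{i₀}^{α−1}·Σ_{i≠i₀} a_i| ≤ M·( Σ_{i≠i₀, k≠i} a_i^{α−1}·min(a_i, a_k) + Σ_{i≠i₀} a_{i₀}^{α−2}·min(a_{i₀}², a_i²) + (Σ_{i≠i₀} min(a_{i₀}^{α−1}, a_i^{α−1}))·(Σ_{i≠i₀} a_i) ), where the first sum runs over ordered pairs (i,k) with i ≠ i₀ and k ≠ i. -/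
open Finset

/-- Tangent line inequality for the convex function `t ↦ t ^ β`. -/
theorem rpow_tangent_le {β u v : ℝ} (hβ : 1 ≤ β) (hu : 0 < u) (hv : 0 ≤ v) :
    u ^ β + β * u ^ (β - 1) * (v - u) ≤ v ^ β := by
  have hs : -1 ≤ (v - u) / u := by
    rw [le_div_iff₀ hu]; linarith
  have h := one_add_mul_self_le_rpow_one_add hs hβ
  have h1 : 1 + (v - u) / u = v / u := by field_simp; ring
  rw [h1, Real.div_rpow hv hu.le, le_div_iff₀ (Real.rpow_pos_of_pos hu β)] at h
  have h2 : u ^ β = u ^ (β - 1) * u := by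
    rw [← Real.rpow_add_one hu.ne']; ring_nf
  have h3 : (1 + β * ((v - u) / u)) * u ^ β = u ^ β + β * u ^ (β - 1) * (v - u) := by
    rw [h2]; field_simp
  linarith

theorem abs_rpow_add_sub_le_of_ge {α x y : ℝ} (hα : 2 ≤ α) (hx : 0 < x) (hy : 0 < y)
    (hxy : y ≤ x) :
    |(x + y) ^ α - x ^ α - y ^ α - α * x ^ (α - 1) * y|
      ≤ (α * (α - 1) * 2 ^ (α - 2) + 1) * (x ^ (α - 2) * y ^ 2) := by
  have h1 := rpow_tangent_le (β := α) (by linarith) hx (add_pos hx hy).le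
  have h2 := rpow_tangent_le (β := α) (by linarith) (add_pos hx hy) hx.le
  have h3 := rpow_tangent_le (β := α - 1) (by linarith) (add_pos hx hy) hx.le
  have h4 : (x + y) ^ (α - 2) ≤ 2 ^ (α - 2) * x ^ (α - 2) := by
    rw [← Real.mul_rpow (by norm_num) hx.le]
    exact Real.rpow_le_rpow (by positivity) (by linarith) (by linarith)
  have h5 : y ^ α ≤ x ^ (α - 2) * y ^ 2 := by
    have : y ^ α = y ^ (α - 2) * y ^ 2 := by
      rw [← Real.rpow_natCast y 2, ← Real.rpow_add hy]; norm_num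
    rw [this]
    gcongr
  have h6 : 0 < y ^ α := by positivity
  rw [show α - 1 - 1 = α - 2 by ring] at h3
  have h7 : 0 ≤ (α - 1) * y := mul_nonneg (by linarith) hy.le
  have h8 := mul_le_mul_of_nonneg_left h4 h7
  have h9 : (x + y) ^ (α - 1) ≤
      x ^ (α - 1) + (α - 1) * y * (2 ^ (α - 2) * x ^ (α - 2)) := by linarith
  have h10 := mul_le_mul_of_nonneg_left h9 (show 0 ≤ α * y by positivity)
  have h11 : 0 ≤ α * (α - 1) * 2 ^ (α - 2) * (x ^ (α - 2) * y ^ 2) := by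
    have : 0 ≤ α - 1 := by linarith
    positivity
  rw [abs_le]
  constructor <;> linarith

theorem abs_rpow_add_sub_le_of_le {α x y : ℝ} (hα : 2 ≤ α) (hx : 0 < x) (hxy : x ≤ y) :
    |(x + y) ^ α - x ^ α - y ^ α - α * x ^ (α - 1) * y|
      ≤ (α * 2 ^ (α - 1) + 1 + α) * (y ^ (α - 1) * x) := by
  have hy : 0 < y := hx.trans_le hxy
  have h1 : y ^ α ≤ (x + y) ^ α :=
    Real.rpow_le_rpow hy.le (by linarith) (by linarith)
  have h2 := rpow_tangent_le (β := α) (by linarith) (add_pos hx hy) hy.le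
  have h3 : (x + y) ^ (α - 1) ≤ 2 ^ (α - 1) * y ^ (α - 1) := by
    rw [← Real.mul_rpow (by norm_num) hy.le]
    exact Real.rpow_le_rpow (by positivity) (by linarith) (by linarith)
  have h4 : x ^ α ≤ y ^ (α - 1) * x := by
    have : x ^ α = x ^ (α - 1) * x := by
      rw [← Real.rpow_add_one hx.ne']; ring_nf
    rw [this]
    gcongr
    linarith
  have h5 : x ^ (α - 1) * y ≤ y ^ (α - 1) * x := by
    have e : ∀ z : ℝ, 0 < z → z ^ (α - 1) = z ^ (α - 2) * z := fun z hz => by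
      rw [← Real.rpow_add_one hz.ne']; ring_nf
    have : x ^ (α - 2) ≤ y ^ (α - 2) := Real.rpow_le_rpow hx.le hxy (by linarith)
    rw [e x hx, e y hy]
    have := mul_le_mul_of_nonneg_right this (mul_pos hx hy).le
    linarith
  have h6 := mul_le_mul_of_nonneg_left h3 (show 0 ≤ α * x by positivity)
  have h7 := mul_le_mul_of_nonneg_left h5 (show 0 ≤ α by linarith)
  have h8 : 0 < x ^ α := by positivity
  have h9 : 0 < α * x ^ (α - 1) * y := by positivity
  have h10 : 0 < α * 2 ^ (α - 1) * (y ^ (α - 1) * x) := by positivity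
  rw [abs_le]
  constructor <;> linarith

theorem sum_rpow_le_rpow_sum {ι : Type*} (s : Finset ι) {a : ι → ℝ} {α : ℝ} (hα : 1 ≤ α)
    (ha : ∀ i ∈ s, 0 < a i) : ∑ i ∈ s, a i ^ α ≤ (∑ i ∈ s, a i) ^ α := by
  rcases s.eq_empty_or_nonempty with rfl | hs
  · simp [Real.zero_rpow (show α ≠ 0 by linarith)]
  have hS : 0 < ∑ i ∈ s, a i := Finset.sum_pos ha hs
  calc ∑ i ∈ s, a i ^ α ≤ ∑ i ∈ s, (∑ j ∈ s, a j) ^ (α - 1) * a i := by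
        refine Finset.sum_le_sum fun i hi => ?_
        have hi0 := ha i hi
        have hle : a i ≤ ∑ j ∈ s, a j :=
          Finset.single_le_sum (fun j hj => (ha j hj).le) hi
        rw [show a i ^ α = a i ^ (α - 1) * a i by
          rw [← Real.rpow_add_one hi0.ne']; ring_nf]
        gcongr
    _ = (∑ i ∈ s, a i) ^ α := by
        rw [← Finset.mul_sum, ← Real.rpow_add_one hS.ne']; ring_nf

/-- The `α`-th power of a sum exceeds the power of its largest term by at most a multiple of the
interactions of that term with the others. -/
theorem rpow_sum_le_rpow_add_of_forall_le {ι : Type*} [DecidableEq ι] {s : Finset ι} {a : ι → ℝ}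
    {α c : ℝ} (hα : 1 ≤ α) (ha : ∀ i ∈ s, 0 < a i) {m : ι} (hm : m ∈ s)
    (hmax : ∀ i ∈ s, a i ≤ a m) (hc : ∑ i ∈ s, a i ≤ c * a m) (hc0 : 0 ≤ c) :
    (∑ i ∈ s, a i) ^ α
      ≤ a m ^ α + α * c ^ (α - 1) * ∑ k ∈ s.erase m, a m ^ (α - 1) * min (a m) (a k) := by
  have hS : 0 < ∑ i ∈ s, a i := Finset.sum_pos ha ⟨m, hm⟩
  have h1 := rpow_tangent_le hα hS (ha m hm).le
  have h2 : (∑ i ∈ s, a i) ^ (α - 1) ≤ c ^ (α - 1) * a m ^ (α - 1) := by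
    rw [← Real.mul_rpow hc0 (ha m hm).le]
    exact Real.rpow_le_rpow hS.le hc (by linarith)
  have h3 : ∑ k ∈ s.erase m, a m ^ (α - 1) * min (a m) (a k)
      = a m ^ (α - 1) * ∑ k ∈ s.erase m, a k := by
    rw [Finset.mul_sum]
    refine Finset.sum_congr rfl fun k hk => ?_
    rw [min_eq_right (hmax k (Finset.mem_of_mem_erase hk))]
  have h4 : a m + ∑ k ∈ s.erase m, a k = ∑ i ∈ s, a i := Finset.add_sum_erase s a hm
  have h5 : 0 ≤ ∑ k ∈ s.erase m, a k :=
    Finset.sum_nonneg fun k hk => (ha k (Finset.mem_of_mem_erase hk)).le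
  have h6 := mul_le_mul_of_nonneg_left h2
    (show 0 ≤ α * ∑ k ∈ s.erase m, a k from mul_nonneg (by linarith) h5)
  rw [h3]
  rw [← h4] at h1 h6 ⊢
  linarith

/-- Lemma 6.5: expansion of a power of a finite sum around a single distinguished term. -/
theorem rpow_sum_expansion_single_bubble (α : ℝ) (hα : 2 ≤ α) (p : ℕ) (hp : 0 < p) :
    ∃ M : ℝ, 0 < M ∧ ∀ (a : Fin p → ℝ) (i₀ : Fin p), (∀ i, 0 < a i) →
      |(∑ i, a i) ^ α - ∑ i, a i ^ α
          - α * a i₀ ^ (α - 1) * ∑ i ∈ Finset.univ.filter (fun i => i ≠ i₀), a i|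
        ≤ M * ((∑ i ∈ Finset.univ.filter (fun i => i ≠ i₀),
                  ∑ k ∈ Finset.univ.filter (fun k => k ≠ i),
                    a i ^ (α - 1) * min (a i) (a k))
             + (∑ i ∈ Finset.univ.filter (fun i => i ≠ i₀),
                  a i₀ ^ (α - 2) * min (a i₀ ^ 2) (a i ^ 2))
             + (∑ i ∈ Finset.univ.filter (fun i => i ≠ i₀),
                  min (a i₀ ^ (α - 1)) (a i ^ (α - 1)))
               * (∑ i ∈ Finset.univ.filter (fun i => i ≠ i₀), a i)) := by
  have hp1 : (1 : ℝ) ≤ p := by exact_mod_cast hp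
  have hp0 : (0 : ℝ) < p := by linarith
  have hα1 : 0 < α - 1 := by linarith
  set C₁ : ℝ := α * (α - 1) * 2 ^ (α - 2) + 1
  set C₂ : ℝ := α * 2 ^ (α - 1) + 1 + α
  set P : ℝ := (p : ℝ) ^ (α - 1) with hP
  have hC₁0 : 0 < C₁ := by positivity
  have hC₂0 : 0 < C₂ := by positivity
  have hP0 : 0 < P := by positivity
  refine ⟨C₁ * p + C₂ * (P * p) + α * P, by positivity, fun a i₀ ha => ?_⟩
  set D : Finset (Fin p) := Finset.univ.filter (fun i => i ≠ i₀) with hD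
  have hsplit : ∀ f : Fin p → ℝ, ∑ i, f i = f i₀ + ∑ i ∈ D, f i := fun f => by
    rw [hD, Finset.filter_ne', Finset.add_sum_erase _ _ (Finset.mem_univ i₀)]
  rw [hsplit a, hsplit fun i => a i ^ α]
  set T₁ := ∑ i ∈ D, ∑ k ∈ Finset.univ.filter (fun k => k ≠ i), a i ^ (α - 1) * min (a i) (a k)
  set T₂ := ∑ i ∈ D, a i₀ ^ (α - 2) * min (a i₀ ^ 2) (a i ^ 2) with hT₂
  set T₃ := (∑ i ∈ D, min (a i₀ ^ (α - 1)) (a i ^ (α - 1))) * ∑ i ∈ D, a i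
  have hterm : ∀ i k, 0 ≤ a i ^ (α - 1) * min (a i) (a k) := fun i k =>
    mul_nonneg (Real.rpow_nonneg (ha i).le _) (le_min (ha i).le (ha k).le)
  have hT₁0 : 0 ≤ T₁ := Finset.sum_nonneg fun i _ => Finset.sum_nonneg fun k _ => hterm i k
  have hT₂0 : 0 ≤ T₂ := Finset.sum_nonneg fun i _ =>
    mul_nonneg (Real.rpow_nonneg (ha i₀).le _) (le_min (sq_nonneg _) (sq_nonneg _))
  have hT₃0 : 0 ≤ T₃ := mul_nonneg
    (Finset.sum_nonneg fun i _ =>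
      le_min (Real.rpow_nonneg (ha i₀).le _) (Real.rpow_nonneg (ha i).le _))
    (Finset.sum_nonneg fun i _ => (ha i).le)
  rcases D.eq_empty_or_nonempty with hE | hne
  · have : |(a i₀ + ∑ i ∈ D, a i) ^ α - (a i₀ ^ α + ∑ i ∈ D, a i ^ α)
        - α * a i₀ ^ (α - 1) * ∑ i ∈ D, a i| = 0 := by simp [hE]
    rw [this]
    positivity
  obtain ⟨m, hm, hmax⟩ := D.exists_max_image a hne
  have hcard : (D.card : ℝ) ≤ p := by
    exact_mod_cast (Finset.card_le_univ D).trans_eq (Fintype.card_fin p)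
  have hT₁m : ∑ k ∈ Finset.univ.filter (fun k => k ≠ m), a m ^ (α - 1) * min (a m) (a k) ≤ T₁ :=
    Finset.single_le_sum
      (f := fun i => ∑ k ∈ Finset.univ.filter (fun k => k ≠ i), a i ^ (α - 1) * min (a i) (a k))
      (fun i _ => Finset.sum_nonneg fun k _ => hterm i k) hm
  have hmi₀ : m ≠ i₀ := (Finset.mem_filter.mp hm).2
  have hS : ∑ i ∈ D, a i ≤ p * a m := by
    calc ∑ i ∈ D, a i ≤ D.card • a m := Finset.sum_le_card_nsmul D a (a m) hmax
      _ = D.card * a m := nsmul_eq_mul _ _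
      _ ≤ p * a m := mul_le_mul_of_nonneg_right hcard (ha m).le
  have hS0 : 0 < ∑ i ∈ D, a i := Finset.sum_pos (fun i _ => ha i) hne
  have hlow := sum_rpow_le_rpow_sum D (a := a) (α := α) (by linarith) fun i _ => ha i
  have hup : (∑ i ∈ D, a i) ^ α - ∑ i ∈ D, a i ^ α ≤ α * P * T₁ := by
    have h1 := rpow_sum_le_rpow_add_of_forall_le (α := α) (by linarith) (fun i _ => ha i) hm hmax
      hS hp0.le
    have h2 : a m ^ α ≤ ∑ i ∈ D, a i ^ α :=
      Finset.single_le_sum (f := fun i => a i ^ α) (fun i _ => Real.rpow_nonneg (ha i).le _) hm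
    have h3 : ∑ k ∈ D.erase m, a m ^ (α - 1) * min (a m) (a k) ≤ T₁ := by
      refine le_trans (Finset.sum_le_sum_of_subset_of_nonneg ?_ fun k _ _ => hterm m k) hT₁m
      intro k hk
      exact Finset.mem_filter.mpr ⟨Finset.mem_univ k, Finset.ne_of_mem_erase hk⟩
    have h4 := mul_le_mul_of_nonneg_left h3 (show 0 ≤ α * P by positivity)
    linarith
  have hpair : |(a i₀ + ∑ i ∈ D, a i) ^ α - a i₀ ^ α - (∑ i ∈ D, a i) ^ α
      - α * a i₀ ^ (α - 1) * ∑ i ∈ D, a i| ≤ C₁ * p * T₂ + C₂ * (P * p) * T₁ := by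
    rcases le_total (∑ i ∈ D, a i) (a i₀) with h | h
    · have h1 := abs_rpow_add_sub_le_of_ge hα (ha i₀) hS0 h
      have h2 : a i₀ ^ (α - 2) * (∑ i ∈ D, a i) ^ 2 ≤ p * T₂ := by
        have hT : T₂ = a i₀ ^ (α - 2) * ∑ i ∈ D, a i ^ 2 := by
          rw [hT₂, Finset.mul_sum]
          refine Finset.sum_congr rfl fun i hi => ?_
          have hi' : a i ≤ a i₀ :=
            (Finset.single_le_sum (fun j _ => (ha j).le) hi).trans h
          rw [min_eq_right (pow_le_pow_left₀ (ha i).le hi' 2)]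
        have h3 : (∑ i ∈ D, a i) ^ 2 ≤ p * ∑ i ∈ D, a i ^ 2 :=
          sq_sum_le_card_mul_sum_sq.trans
            (mul_le_mul_of_nonneg_right hcard (Finset.sum_nonneg fun i _ => sq_nonneg _))
        have h4 := mul_le_mul_of_nonneg_left h3 (Real.rpow_nonneg (ha i₀).le (α - 2))
        rw [hT]
        linarith
      have h3 := mul_le_mul_of_nonneg_left h2 hC₁0.le
      have h4 : 0 ≤ C₂ * (P * p) * T₁ := by positivity
      linarith
    · have h1 := abs_rpow_add_sub_le_of_le hα (ha i₀) h
      have h2 : (∑ i ∈ D, a i) ^ (α - 1) ≤ P * a m ^ (α - 1) := by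
        rw [hP, ← Real.mul_rpow hp0.le (ha m).le]
        exact Real.rpow_le_rpow hS0.le hS hα1.le
      have h3 : a i₀ ≤ p * min (a m) (a i₀) := by
        rw [mul_min_of_nonneg _ _ hp0.le]
        exact le_min (h.trans hS) (le_mul_of_one_le_left (ha i₀).le hp1)
      have h4 : a m ^ (α - 1) * min (a m) (a i₀) ≤ T₁ :=
        (Finset.single_le_sum (f := fun k => a m ^ (α - 1) * min (a m) (a k))
          (fun k _ => hterm m k)
          (Finset.mem_filter.mpr ⟨Finset.mem_univ i₀, hmi₀.symm⟩)).trans hT₁m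
      have h5 : (∑ i ∈ D, a i) ^ (α - 1) * a i₀ ≤
          (P * a m ^ (α - 1)) * (p * min (a m) (a i₀)) :=
        mul_le_mul h2 h3 (ha i₀).le (mul_nonneg hP0.le (Real.rpow_nonneg (ha m).le _))
      have h6 := mul_le_mul_of_nonneg_left h4 (mul_pos hP0 hp0).le
      have h7 : (∑ i ∈ D, a i) ^ (α - 1) * a i₀ ≤ P * p * T₁ := by linarith
      have h8 := mul_le_mul_of_nonneg_left h7 hC₂0.le
      have h9 : 0 ≤ C₁ * p * T₂ := by positivity
      linarith
  have hfin : C₁ * p * T₂ + C₂ * (P * p) * T₁ + α * P * T₁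
      ≤ (C₁ * p + C₂ * (P * p) + α * P) * (T₁ + T₂ + T₃) := by
    have h1 : 0 ≤ C₁ * p * (T₁ + T₃) := by positivity
    have h2 : 0 ≤ C₂ * (P * p) * (T₂ + T₃) := by positivity
    have h3 : 0 ≤ α * P * (T₂ + T₃) := by positivity
    linarith
  refine le_trans ?_ hfin
  rw [abs_le] at hpair ⊢
  have h0 : 0 ≤ α * P * T₁ := by positivity
  constructor <;> linarith [hpair.1, hpair.2]
end

section
/- Let f : ℝ³ → ℝ be twice continuously differentiable. Then, as p = (x,y,t) → 0, f(p) = f(0) + x·(Xf)(0) + y·(Yf)(0) + t·(Tf)(0) + (x²/2)·(X²f)(0) + (y²/2)·(Y²f)(0) + (xy/2)·(XYf)(0) + (xy/2)·(YXf)(0) + o(|p|²), where |p| = ((x²+y²)² + t²)^{1/4} is the homogeneous Heisenberg norm. -/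
/-- The Heisenberg vector field `X = ∂/∂x + 2y·∂/∂t` acting on functions on ℝ³. -/
noncomputable def Xop (f : ℝ × ℝ × ℝ → ℝ) (p : ℝ × ℝ × ℝ) : ℝ :=
  fderiv ℝ f p (1, 0, 2 * p.2.1)

/-- The Heisenberg vector field `Y = ∂/∂y − 2x·∂/∂t` acting on functions on ℝ³. -/
noncomputable def Yop (f : ℝ × ℝ × ℝ → ℝ) (p : ℝ × ℝ × ℝ) : ℝ :=
  fderiv ℝ f p (0, 1, -(2 * p.1))

/-- The vector field `T = ∂/∂t` acting on functions on ℝ³. -/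
noncomputable def Tvf (f : ℝ × ℝ × ℝ → ℝ) (p : ℝ × ℝ × ℝ) : ℝ :=
  fderiv ℝ f p (0, 0, 1)

open Asymptotics Filter Topology

/-- Second-order Taylor expansion with Peano remainder for a `C²` function at the origin. -/
theorem ContDiff.isLittleO_taylor_two {E : Type*} [NormedAddCommGroup E] [NormedSpace ℝ E]
    {f : E → ℝ} (hf : ContDiff ℝ 2 f) :
    (fun p : E => f p - (f 0 + fderiv ℝ f 0 p + 1 / 2 * fderiv ℝ (fderiv ℝ f) 0 p p))
      =o[𝓝 0] (fun p : E => ‖p‖ ^ 2) := by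
  set L := fderiv ℝ f 0
  set B := fderiv ℝ (fderiv ℝ f) 0
  have hdf : Differentiable ℝ f := hf.differentiable (by norm_num)
  have hddf : Differentiable ℝ (fderiv ℝ f) :=
    (hf.fderiv_right (m := 1) (by norm_num)).differentiable (by norm_num)
  have hsymm : IsSymmSndFDerivAt ℝ f 0 := hf.contDiffAt.isSymmSndFDerivAt (by simp)
  have hderiv (p : E) :
      HasFDerivAt (fun p : E => f p - (f 0 + L p + 1 / 2 * B p p)) (fderiv ℝ f p - L - B p) p := by
    have hB : HasFDerivAt (fun p : E => B p p) (B p + B.flip p) p := by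
      refine ((B.hasFDerivAt (x := p)).clm_apply (hasFDerivAt_id p)).congr_fderiv ?_
      ext v
      simp
    refine ((hdf p).hasFDerivAt.sub
      (((hasFDerivAt_const (f 0) p).add L.hasFDerivAt).add (hB.const_mul (1 / 2)))).congr_fderiv ?_
    ext v
    have hv : B v p = B p v := hsymm v p
    simp [hv]
    ring
  have hB : (fun p => fderiv ℝ f p - L - B p) =o[𝓝 0] (fun p : E => p) := by
    simpa using (hddf 0).hasFDerivAt.isLittleO
  have hfirst : (fun p => fderiv ℝ f p - L - B p) =o[𝓝[Set.univ] 0] (fun p : E => ‖p - 0‖ ^ 1) := by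
    simpa using hB.norm_right
  simpa using convex_univ.isLittleO_pow_succ (Set.mem_univ 0)
    (fun p _ => (hderiv p).hasFDerivWithinAt) hfirst

/-- Derivative at the origin of a `C²` function differentiated along an affine vector field. -/
theorem ContDiff.fderiv_fderiv_apply {E : Type*} [NormedAddCommGroup E] [NormedSpace ℝ E]
    {f : E → ℝ} (hf : ContDiff ℝ 2 f) (u : E) (A : E →L[ℝ] E) (v : E) :
    fderiv ℝ (fun p => fderiv ℝ f p (u + A p)) 0 v =
      fderiv ℝ (fderiv ℝ f) 0 v u + fderiv ℝ f 0 (A v) := by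
  have hddf : Differentiable ℝ (fderiv ℝ f) :=
    (hf.fderiv_right (m := 1) (by norm_num)).differentiable (by norm_num)
  rw [((hddf 0).hasFDerivAt.clm_apply ((A.hasFDerivAt (x := 0)).const_add u)).fderiv]
  simp [add_comm]

/-- The part of `X` depending on the base point. -/
noncomputable def heisenbergXLin : (ℝ × ℝ × ℝ) →L[ℝ] ℝ × ℝ × ℝ :=
  (0 : (ℝ × ℝ × ℝ) →L[ℝ] ℝ).prod ((0 : (ℝ × ℝ × ℝ) →L[ℝ] ℝ).prod
    ((2 : ℝ) • (ContinuousLinearMap.fst ℝ ℝ ℝ).comp (ContinuousLinearMap.snd ℝ ℝ (ℝ × ℝ))))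

/-- The part of `Y` depending on the base point. -/
noncomputable def heisenbergYLin : (ℝ × ℝ × ℝ) →L[ℝ] ℝ × ℝ × ℝ :=
  (0 : (ℝ × ℝ × ℝ) →L[ℝ] ℝ).prod ((0 : (ℝ × ℝ × ℝ) →L[ℝ] ℝ).prod
    (-(2 : ℝ) • ContinuousLinearMap.fst ℝ ℝ (ℝ × ℝ)))

theorem fderiv_Xop {f : ℝ × ℝ × ℝ → ℝ} (hf : ContDiff ℝ 2 f) (v : ℝ × ℝ × ℝ) :
    fderiv ℝ (Xop f) 0 v =
      fderiv ℝ (fderiv ℝ f) 0 v (1, 0, 0) + fderiv ℝ f 0 (0, 0, 2 * v.2.1) := by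
  have h : Xop f = fun p => fderiv ℝ f p ((1, 0, 0) + heisenbergXLin p) := by
    ext p
    simp [Xop, heisenbergXLin]
  rw [h, hf.fderiv_fderiv_apply]
  simp [heisenbergXLin]

theorem fderiv_Yop {f : ℝ × ℝ × ℝ → ℝ} (hf : ContDiff ℝ 2 f) (v : ℝ × ℝ × ℝ) :
    fderiv ℝ (Yop f) 0 v =
      fderiv ℝ (fderiv ℝ f) 0 v (0, 1, 0) + fderiv ℝ f 0 (0, 0, -(2 * v.1)) := by
  have h : Yop f = fun p => fderiv ℝ f p ((0, 1, 0) + heisenbergYLin p) := by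
    ext p
    simp [Yop, heisenbergYLin]
  rw [h, hf.fderiv_fderiv_apply]
  simp [heisenbergYLin]

/-- The square of the sup norm is dominated near the origin by the squared homogeneous norm. -/
theorem norm_sq_isBigO_heisenberg :
    (fun p : ℝ × ℝ × ℝ => ‖p‖ ^ 2) =O[𝓝 0]
      (fun p : ℝ × ℝ × ℝ => Real.sqrt ((p.1 ^ 2 + p.2.1 ^ 2) ^ 2 + p.2.2 ^ 2)) := by
  refine IsBigO.of_bound 1 ?_
  filter_upwards [Metric.ball_mem_nhds (0 : ℝ × ℝ × ℝ) one_pos] with p hp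
  obtain ⟨x, y, t⟩ := p
  rw [mem_ball_zero_iff, Prod.norm_mk, Prod.norm_mk, max_lt_iff, max_lt_iff] at hp
  have ht : |t| ≤ 1 := hp.2.2.le
  have ht2 : t ^ 2 ≤ 1 := (sq_le_one_iff_abs_le_one t).2 ht
  rw [one_mul, Real.norm_of_nonneg (by positivity), Real.norm_of_nonneg (Real.sqrt_nonneg _)]
  apply Real.le_sqrt_of_sq_le
  rw [Prod.norm_mk, Prod.norm_mk]
  rcases max_choice ‖x‖ (max ‖y‖ ‖t‖) with h | h <;> rw [h]
  · simp only [Real.norm_eq_abs, sq_abs]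
    nlinarith [sq_nonneg x, sq_nonneg y, sq_nonneg t, mul_nonneg (sq_nonneg x) (sq_nonneg y)]
  · rcases max_choice ‖y‖ ‖t‖ with h | h <;> rw [h] <;> simp only [Real.norm_eq_abs, sq_abs]
    · nlinarith [sq_nonneg x, sq_nonneg y, sq_nonneg t, mul_nonneg (sq_nonneg x) (sq_nonneg y)]
    · nlinarith [sq_nonneg (x ^ 2 + y ^ 2), mul_nonneg (sq_nonneg t) (sub_nonneg.2 ht2)]

theorem snd_snd_isBigO_heisenberg :
    (fun p : ℝ × ℝ × ℝ => p.2.2) =O[𝓝 0]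
      (fun p : ℝ × ℝ × ℝ => Real.sqrt ((p.1 ^ 2 + p.2.1 ^ 2) ^ 2 + p.2.2 ^ 2)) := by
  refine IsBigO.of_bound' (Eventually.of_forall fun p => ?_)
  rw [Real.norm_of_nonneg (Real.sqrt_nonneg _)]
  exact Real.abs_le_sqrt (by nlinarith [sq_nonneg (p.1 ^ 2 + p.2.1 ^ 2)])

/-- Heisenberg-group Taylor expansion at the origin for `C²` functions:
`f(p) = f(0) + x·Xf(0) + y·Yf(0) + t·Tf(0) + (x²/2)·X²f(0) + (y²/2)·Y²f(0)
        + (xy/2)·XYf(0) + (xy/2)·YXf(0) + o(|p|²)`,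
where `|p| = ((x²+y²)² + t²)^{1/4}` is the homogeneous Heisenberg norm. -/
theorem heisenberg_taylor_expansion (f : ℝ × ℝ × ℝ → ℝ) (hf : ContDiff ℝ 2 f) :
    (fun p : ℝ × ℝ × ℝ =>
        f p - (f 0 + p.1 * Xop f 0 + p.2.1 * Yop f 0 + p.2.2 * Tvf f 0
          + p.1 ^ 2 / 2 * Xop (Xop f) 0 + p.2.1 ^ 2 / 2 * Yop (Yop f) 0
          + p.1 * p.2.1 / 2 * Xop (Yop f) 0 + p.1 * p.2.1 / 2 * Yop (Xop f) 0))
      =o[nhds (0 : ℝ × ℝ × ℝ)]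
      (fun p : ℝ × ℝ × ℝ => Real.sqrt ((p.1 ^ 2 + p.2.1 ^ 2) ^ 2 + p.2.2 ^ 2)) := by
  set L := fderiv ℝ f 0 with hL
  set B := fderiv ℝ (fderiv ℝ f) 0 with hB
  have hXX : Xop (Xop f) 0 = B (1, 0, 0) (1, 0, 0) := by
    have h0 : ((0, 0, 0) : ℝ × ℝ × ℝ) = 0 := rfl
    rw [Xop, fderiv_Xop hf]
    simp [hB, h0]
  have hYY : Yop (Yop f) 0 = B (0, 1, 0) (0, 1, 0) := by
    have h0 : ((0, 0, 0) : ℝ × ℝ × ℝ) = 0 := rfl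
    rw [Yop, fderiv_Yop hf]
    simp [hB, h0]
  have hXY : Xop (Yop f) 0 = B (1, 0, 0) (0, 1, 0) - 2 * L (0, 0, 1) := by
    have h2 : ((0, 0, -2) : ℝ × ℝ × ℝ) = (-2 : ℝ) • (0, 0, 1) := by simp
    rw [Xop, fderiv_Yop hf]
    simp only [mul_one, Prod.fst_zero, Prod.snd_zero, mul_zero, h2, map_smul, smul_eq_mul]
    ring
  have hYX : Yop (Xop f) 0 = B (0, 1, 0) (1, 0, 0) + 2 * L (0, 0, 1) := by
    have h2 : ((0, 0, 2) : ℝ × ℝ × ℝ) = (2 : ℝ) • (0, 0, 1) := by simp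
    rw [Yop, fderiv_Xop hf]
    simp only [mul_one, Prod.fst_zero, mul_zero, neg_zero, h2, map_smul, smul_eq_mul, hL, hB]
  have hlin (p : ℝ × ℝ × ℝ) (M : ℝ × ℝ × ℝ →L[ℝ] ℝ) :
      M p = p.1 * M (1, 0, 0) + p.2.1 * M (0, 1, 0) + p.2.2 * M (0, 0, 1) := by
    simp only [← smul_eq_mul, ← map_smul, ← map_add]
    simp
  have hsmall : (fun p : ℝ × ℝ × ℝ => p.2.2 * ((B p (0, 0, 1) + B (0, 0, 1) (p.1, p.2.1, 0)) / 2))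
      =o[𝓝 0] (fun p : ℝ × ℝ × ℝ => Real.sqrt ((p.1 ^ 2 + p.2.1 ^ 2) ^ 2 + p.2.2 ^ 2)) := by
    have hc : Tendsto (fun p : ℝ × ℝ × ℝ => (B p (0, 0, 1) + B (0, 0, 1) (p.1, p.2.1, 0)) / 2)
        (𝓝 0) (𝓝 0) := by
      have h0 : ((0, 0, 0) : ℝ × ℝ × ℝ) = 0 := rfl
      have : Continuous
          (fun p : ℝ × ℝ × ℝ => (B p (0, 0, 1) + B (0, 0, 1) (p.1, p.2.1, 0)) / 2) := by fun_prop
      simpa [h0] using this.tendsto 0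
    simpa using snd_snd_isBigO_heisenberg.mul_isLittleO ((isLittleO_one_iff ℝ).2 hc)
  refine ((hf.isLittleO_taylor_two.trans_isBigO norm_sq_isBigO_heisenberg).add hsmall).congr_left
    fun p => ?_
  have hX : Xop f 0 = L (1, 0, 0) := by simp [Xop, hL]
  have hY : Yop f 0 = L (0, 1, 0) := by simp [Yop, hL]
  have hT : Tvf f 0 = L (0, 0, 1) := rfl
  have hBp (w : ℝ × ℝ × ℝ) : B p w =
      p.1 * B (1, 0, 0) w + p.2.1 * B (0, 1, 0) w + p.2.2 * B (0, 0, 1) w :=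
    hlin p (B.flip w)
  rw [hXX, hYY, hXY, hYX, hX, hY, hT, ← hL, ← hB, hlin p L, hlin p (B p),
    hlin (p.1, p.2.1, 0) (B (0, 0, 1)), hBp, hBp, hBp]
  ring
end

section
/- There exist constants ε₀ ∈ (0,1) and C₂ ≥ C₁ > 0 (depending only on γ and c₀) such that for all a_i, a_j ∈ ℝ³ and λ_i, λ_j > 0 with ε_ij ≤ ε₀, C₁·ε_ij ≤ ∫_{ℝ³} δ_{a_i,λ_i}(u)^{(2+γ)/(2−γ)} · δ_{a_j,λ_j}(u) du ≤ C₂·ε_ij. -/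
open MeasureTheory Real

/-- The standard bubble
`δ_{a,λ}(x,y,t) = c₀·λ^{2−γ}·[(1 + λ²((x−x_a)² + (y−y_a)²))² + λ⁴(t − t_a + 2(x_a y − x y_a))²]^{−(2−γ)/2}`
on `ℝ³`. -/
noncomputable def bubble (γ c₀ : ℝ) (a : ℝ × ℝ × ℝ) (l : ℝ) (u : ℝ × ℝ × ℝ) : ℝ :=
  c₀ * l ^ (2 - γ) *
    ((1 + l ^ 2 * ((u.1 - a.1) ^ 2 + (u.2.1 - a.2.1) ^ 2)) ^ 2
        + l ^ 4 * (u.2.2 - a.2.2 + 2 * (a.1 * u.2.1 - u.1 * a.2.1)) ^ 2) ^ (-(2 - γ) / 2)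

/-- The homogeneous (gauge) distance
`d(a_i,a_j) = [((x_i−x_j)² + (y_i−y_j)²)² + (t_i − t_j + 2x_j y_i − 2x_i y_j)²]^{1/4}`. -/
noncomputable def gdist (ai aj : ℝ × ℝ × ℝ) : ℝ :=
  (((ai.1 - aj.1) ^ 2 + (ai.2.1 - aj.2.1) ^ 2) ^ 2
      + (ai.2.2 - aj.2.2 + 2 * aj.1 * ai.2.1 - 2 * ai.1 * aj.2.1) ^ 2) ^ ((1 : ℝ) / 4)

/-- The interaction quantity
`ε_ij = (λ_i/λ_j + λ_j/λ_i + λ_i λ_j d(a_i,a_j)²)^{−(2−γ)}`. -/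
noncomputable def epsb (γ : ℝ) (ai aj : ℝ × ℝ × ℝ) (li lj : ℝ) : ℝ :=
  (li / lj + lj / li + li * lj * gdist ai aj ^ 2) ^ (-(2 - γ))

/-- The left-translated and dilated coordinates of `u`, centred at `a`, at scale `l`. -/
def heisChart (a : ℝ × ℝ × ℝ) (l : ℝ) (u : ℝ × ℝ × ℝ) : ℝ × ℝ × ℝ :=
  (l * (u.1 - a.1), l * (u.2.1 - a.2.1),
    l ^ 2 * (u.2.2 - a.2.2 + 2 * (a.1 * u.2.1 - u.1 * a.2.1)))

/-- A quantity comparable to the square of the homogeneous gauge. -/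
def gaugeSq (w : ℝ × ℝ × ℝ) : ℝ := w.1 ^ 2 + w.2.1 ^ 2 + |w.2.2|

/-- An integrable even profile on the line, singular at the origin. -/
noncomputable def lineProfile (γ s : ℝ) : ℝ :=
  min (|s| ^ (-(1 - γ / 2))) (|s| ^ (-(1 + γ / 2)))

/-- The product of three line profiles. -/
noncomputable def prodProfile (γ : ℝ) (w : ℝ × ℝ × ℝ) : ℝ :=
  lineProfile γ w.1 * (lineProfile γ w.2.1 * lineProfile γ w.2.2)

lemma gaugeSq_nonneg (w : ℝ × ℝ × ℝ) : 0 ≤ gaugeSq w := by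
  unfold gaugeSq; positivity

lemma measurePreserving_heisTranslate (a : ℝ × ℝ × ℝ) :
    MeasurePreserving (heisChart a 1) volume volume := by
  have hinner : ∀ x : ℝ, MeasurePreserving
      (fun p : ℝ × ℝ => (p.1 - a.2.1, p.2 - a.2.2 + 2 * (a.1 * p.1 - x * a.2.1)))
      (volume.prod volume) (volume.prod volume) := by
    intro x
    refine MeasurePreserving.skew_product (measurePreserving_sub_right volume a.2.1)
      (g := fun y t => t - a.2.2 + 2 * (a.1 * y - x * a.2.1)) (by fun_prop) ?_
    refine Filter.Eventually.of_forall fun y => ?_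
    simp only [sub_add]
    exact (measurePreserving_sub_right volume _).map_eq
  have h := MeasurePreserving.skew_product (measurePreserving_sub_right volume a.1)
      (g := fun x (p : ℝ × ℝ) => (p.1 - a.2.1, p.2 - a.2.2 + 2 * (a.1 * p.1 - x * a.2.1)))
      (by fun_prop) (Filter.Eventually.of_forall fun x => (hinner x).map_eq)
  have e : heisChart a 1 = fun p => (p.1 - a.1, p.2.1 - a.2.1,
      p.2.2 - a.2.2 + 2 * (a.1 * p.2.1 - p.1 * a.2.1)) := by
    funext u
    simp [heisChart]
  rw [e]
  exact h

lemma map_heisDilate {l : ℝ} (hl : 0 < l) :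
    Measure.map (fun w : ℝ × ℝ × ℝ => (l * w.1, l * w.2.1, l ^ 2 * w.2.2)) volume
      = ENNReal.ofReal (l ^ 4)⁻¹ • volume := by
  have h1 := Real.map_volume_mul_left hl.ne'
  have h2 := Real.map_volume_mul_left (pow_pos hl 2).ne'
  have e2 : Measure.map (fun p : ℝ × ℝ => (l * p.1, l ^ 2 * p.2)) (volume.prod volume)
      = ENNReal.ofReal (l ^ 3)⁻¹ • (volume.prod volume) := by
    have := Measure.map_prod_map (volume : Measure ℝ) (volume : Measure ℝ)
      (measurable_const_mul l) (measurable_const_mul (l ^ 2))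
    rw [h1, h2, Measure.prod_smul_left, Measure.prod_smul_right, smul_smul,
      ← ENNReal.ofReal_mul (abs_nonneg _), abs_of_pos (by positivity),
      abs_of_pos (by positivity)] at this
    rw [show (l ^ 3)⁻¹ = l⁻¹ * (l ^ 2)⁻¹ by field_simp, this]
    rfl
  have := Measure.map_prod_map (volume : Measure ℝ) (volume.prod volume : Measure (ℝ × ℝ))
      (measurable_const_mul l)
      (g := fun p : ℝ × ℝ => (l * p.1, l ^ 2 * p.2)) (by fun_prop)
  rw [h1, e2, Measure.prod_smul_left, Measure.prod_smul_right, smul_smul,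
      ← ENNReal.ofReal_mul (abs_nonneg _), abs_of_pos (by positivity)] at this
  rw [show (l ^ 4)⁻¹ = l⁻¹ * (l ^ 3)⁻¹ by field_simp, Measure.volume_eq_prod,
    Measure.volume_eq_prod, this]
  rfl

lemma continuous_heisChart (a : ℝ × ℝ × ℝ) (l : ℝ) : Continuous (heisChart a l) := by
  unfold heisChart; fun_prop

lemma map_heisChart (a : ℝ × ℝ × ℝ) {l : ℝ} (hl : 0 < l) :
    Measure.map (heisChart a l) volume = ENNReal.ofReal (l ^ 4)⁻¹ • volume := by
  rw [← map_heisDilate hl]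
  conv_rhs => rw [← (measurePreserving_heisTranslate a).map_eq]
  rw [Measure.map_map (by fun_prop) (continuous_heisChart a 1).measurable]
  congr 1
  ext u <;> simp [heisChart]

lemma integrable_comp_heisChart (a : ℝ × ℝ × ℝ) {l : ℝ} (hl : 0 < l) {F : ℝ × ℝ × ℝ → ℝ}
    (hF : Integrable F) : Integrable fun u => F (heisChart a l u) := by
  refine Integrable.comp_measurable (f := heisChart a l) ?_ (continuous_heisChart a l).measurable
  rw [map_heisChart a hl]
  exact hF.smul_measure ENNReal.ofReal_ne_top

lemma integral_comp_heisChart (a : ℝ × ℝ × ℝ) {l : ℝ} (hl : 0 < l) {F : ℝ × ℝ × ℝ → ℝ}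
    (hF : Integrable F) : ∫ u, F (heisChart a l u) = (l ^ 4)⁻¹ * ∫ w, F w := by
  rw [← integral_map (f := F) (continuous_heisChart a l).aemeasurable, map_heisChart a hl,
    integral_smul_measure, ENNReal.toReal_ofReal (by positivity), smul_eq_mul]
  rw [map_heisChart a hl]
  exact hF.aestronglyMeasurable.mono_ac (Measure.smul_absolutelyContinuous)

lemma lineProfile_nonneg (γ s : ℝ) : 0 ≤ lineProfile γ s := by
  unfold lineProfile; positivity

lemma integrable_lineProfile {γ : ℝ} (h0 : 0 < γ) : Integrable (lineProfile γ) := by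
  have hIoi : IntegrableOn (fun s => min (s ^ (-(1 - γ / 2))) (s ^ (-(1 + γ / 2))))
      (Set.Ioi (0 : ℝ)) := by
    have hm : Measurable (fun s : ℝ => min (s ^ (-(1 - γ / 2))) (s ^ (-(1 + γ / 2)))) := by
      fun_prop
    rw [← Set.Ioc_union_Ioi_eq_Ioi zero_le_one]
    refine IntegrableOn.union ?_ ?_
    · have h := (intervalIntegral.intervalIntegrable_rpow' (a := 0) (b := 1)
        (r := -(1 - γ / 2)) (by linarith)).1
      refine Integrable.mono' h hm.aestronglyMeasurable ?_
      filter_upwards [ae_restrict_mem measurableSet_Ioc] with s hs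
      have := hs.1
      rw [Real.norm_of_nonneg (by positivity)]
      exact min_le_left _ _
    · have h := integrableOn_Ioi_rpow_of_lt (a := -(1 + γ / 2)) (by linarith) one_pos
      refine Integrable.mono' h hm.aestronglyMeasurable ?_
      filter_upwards [ae_restrict_mem measurableSet_Ioi] with s hs
      have : 0 < s := one_pos.trans hs
      rw [Real.norm_of_nonneg (by positivity)]
      exact min_le_right _ _
  have hpos : IntegrableOn (lineProfile γ) (Set.Ioi 0) := by
    refine hIoi.congr_fun (fun s hs => ?_) measurableSet_Ioi
    simp only [lineProfile, abs_of_pos (Set.mem_Ioi.1 hs)]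
  have hneg : IntegrableOn (lineProfile γ) (Set.Iic 0) := by
    rw [← Measure.map_neg_eq_self (volume : Measure ℝ)]
    have hm : MeasurableEmbedding (Neg.neg : ℝ → ℝ) := (Homeomorph.neg ℝ).measurableEmbedding
    rw [hm.integrableOn_map_iff]
    have he : lineProfile γ ∘ Neg.neg = lineProfile γ := by
      funext s
      simp [lineProfile]
    rw [he]
    simpa using Iff.mpr integrableOn_Ici_iff_integrableOn_Ioi hpos
  rw [← integrableOn_univ, ← Set.Iic_union_Ioi (a := (0 : ℝ))]
  exact hneg.union hpos

lemma integrable_prodProfile {γ : ℝ} (h0 : 0 < γ) :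
    Integrable (prodProfile γ) :=
  (integrable_lineProfile h0).mul_prod
    ((integrable_lineProfile h0).mul_prod (integrable_lineProfile h0))

lemma prodProfile_nonneg (γ : ℝ) (w : ℝ × ℝ × ℝ) : 0 ≤ prodProfile γ w :=
  mul_nonneg (lineProfile_nonneg _ _) (mul_nonneg (lineProfile_nonneg _ _) (lineProfile_nonneg _ _))

lemma lineProfile_anti {γ : ℝ} (h0 : 0 < γ) (h1 : γ < 1) {s R : ℝ} (hs : s ≠ 0) (h : |s| ≤ R) :
    lineProfile γ R ≤ lineProfile γ s := by
  have hs' : 0 < |s| := abs_pos.2 hs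
  have h' : |s| ≤ |R| := h.trans (le_abs_self R)
  unfold lineProfile
  exact min_le_min (Real.rpow_le_rpow_of_nonpos hs' h' (by linarith))
    (Real.rpow_le_rpow_of_nonpos hs' h' (by linarith))

lemma min_rpow_le_prodProfile {γ : ℝ} (h0 : 0 < γ) (h1 : γ < 1) {w : ℝ × ℝ × ℝ}
    (hw : w.1 ≠ 0 ∧ w.2.1 ≠ 0 ∧ w.2.2 ≠ 0) :
    min (gaugeSq w ^ (-(2 - γ))) (gaugeSq w ^ (-(2 + γ))) ≤ prodProfile γ w := by
  obtain ⟨hx, hy, ht⟩ := hw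
  set q := gaugeSq w with hq
  have ht' : 0 < |w.2.2| := abs_pos.2 ht
  have hq0 : 0 < q := by rw [hq, gaugeSq]; positivity
  have ax : |w.1| ≤ √q := Real.abs_le_sqrt (by rw [hq, gaugeSq]; nlinarith [sq_nonneg w.2.1])
  have ay : |w.2.1| ≤ √q := Real.abs_le_sqrt (by rw [hq, gaugeSq]; nlinarith [sq_nonneg w.1])
  have at' : |w.2.2| ≤ q := by rw [hq, gaugeSq]; nlinarith [sq_nonneg w.2.1, sq_nonneg w.1]
  have key : lineProfile γ √q * (lineProfile γ √q * lineProfile γ q) ≤ prodProfile γ w := by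
    have n1 := lineProfile_nonneg γ √q
    have n2 := lineProfile_nonneg γ q
    have n3 := lineProfile_nonneg γ w.1
    have n4 := lineProfile_nonneg γ w.2.1
    unfold prodProfile
    gcongr
    exacts [lineProfile_anti h0 h1 hx ax, lineProfile_anti h0 h1 hy ay,
      lineProfile_anti h0 h1 ht at']
  refine le_trans ?_ key
  have e : ∀ p : ℝ, |√q| ^ p = q ^ (p / 2) := fun p => by
    rw [abs_of_nonneg (Real.sqrt_nonneg q), Real.sqrt_eq_rpow, ← Real.rpow_mul hq0.le]
    congr 1; ring
  simp only [lineProfile, e, abs_of_pos hq0]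
  rcases le_total q 1 with h | h
  · have hm : ∀ r s : ℝ, s ≤ r → min (q ^ r) (q ^ s) = q ^ r := fun r s hrs =>
      min_eq_left (Real.rpow_le_rpow_of_exponent_ge hq0 h hrs)
    rw [hm _ _ (by linarith), hm _ _ (by linarith), hm _ _ (by linarith),
      ← Real.rpow_add hq0, ← Real.rpow_add hq0]
    apply le_of_eq; congr 1; ring
  · have hm : ∀ r s : ℝ, s ≤ r → min (q ^ r) (q ^ s) = q ^ s := fun r s hrs =>
      min_eq_right (Real.rpow_le_rpow_of_exponent_le h hrs)
    rw [hm _ _ (by linarith), hm _ _ (by linarith), hm _ _ (by linarith),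
      ← Real.rpow_add hq0, ← Real.rpow_add hq0]
    apply le_of_eq; congr 1; ring

lemma ae_heisChart_ne_zero (a : ℝ × ℝ × ℝ) {l : ℝ} (hl : 0 < l) :
    ∀ᵐ u : ℝ × ℝ × ℝ, (heisChart a l u).1 ≠ 0 ∧ (heisChart a l u).2.1 ≠ 0 ∧
      (heisChart a l u).2.2 ≠ 0 := by
  have h0 : ∀ᵐ s : ℝ, s ≠ 0 := Measure.ae_ne volume 0
  have hf : Measure.QuasiMeasurePreserving (Prod.fst : ℝ × ℝ × ℝ → ℝ) volume volume :=
    Measure.quasiMeasurePreserving_fst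
  have hs : Measure.QuasiMeasurePreserving (Prod.snd : ℝ × ℝ × ℝ → ℝ × ℝ) volume volume :=
    Measure.quasiMeasurePreserving_snd
  have hf' : Measure.QuasiMeasurePreserving (Prod.fst : ℝ × ℝ → ℝ) volume volume :=
    Measure.quasiMeasurePreserving_fst
  have hs' : Measure.QuasiMeasurePreserving (Prod.snd : ℝ × ℝ → ℝ) volume volume :=
    Measure.quasiMeasurePreserving_snd
  have h : ∀ᵐ w : ℝ × ℝ × ℝ, w.1 ≠ 0 ∧ w.2.1 ≠ 0 ∧ w.2.2 ≠ 0 := by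
    filter_upwards [hf.ae h0, (hf'.comp hs).ae h0, (hs'.comp hs).ae h0] with w h1 h2 h3
    exact ⟨h1, h2, h3⟩
  have hT : Measure.QuasiMeasurePreserving (heisChart a l) volume volume :=
    ⟨(continuous_heisChart a l).measurable, by
      rw [map_heisChart a hl]; exact Measure.smul_absolutelyContinuous⟩
  exact hT.ae h

lemma quasi_triangle {a b c d a' b' s t r : ℝ} (h1 : a' ^ 2 ≤ 2 * (a ^ 2 + c ^ 2))
    (h2 : b' ^ 2 ≤ 2 * (b ^ 2 + d ^ 2)) (h3 : |r| ≤ |s| + |t| + 2 * |c * b - a * d|) :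
    a' ^ 2 + b' ^ 2 + |r| ≤ 3 * ((a ^ 2 + b ^ 2 + |s|) + (c ^ 2 + d ^ 2 + |t|)) := by
  have : 2 * |c * b - a * d| ≤ a ^ 2 + b ^ 2 + c ^ 2 + d ^ 2 := by
    rcases abs_cases (c * b - a * d) with ⟨h, -⟩ | ⟨h, -⟩ <;> rw [h] <;>
      nlinarith [sq_nonneg (c - b), sq_nonneg (c + b), sq_nonneg (a - d), sq_nonneg (a + d)]
  have := abs_nonneg s
  have := abs_nonneg t
  linarith

lemma abs_le_abs_add_three {r s t e : ℝ} (h : r = s + t + e) : |r| ≤ |s| + |t| + |e| := by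
  rw [h]; exact abs_add_three s t e

lemma gaugeSq_heisChart (a : ℝ × ℝ × ℝ) (l : ℝ) (u : ℝ × ℝ × ℝ) :
    gaugeSq (heisChart a l u) = l ^ 2 * gaugeSq (heisChart a 1 u) := by
  simp only [gaugeSq, heisChart, abs_mul, abs_pow, abs_one, sq_abs]
  ring

lemma gaugeSq_triangle (ai aj : ℝ × ℝ × ℝ) (l : ℝ) (u : ℝ × ℝ × ℝ) :
    gaugeSq (heisChart aj l u)
      ≤ 3 * (gaugeSq (heisChart ai l u) + gaugeSq (heisChart aj l ai)) := by
  rw [gaugeSq_heisChart aj, gaugeSq_heisChart ai, gaugeSq_heisChart aj l ai, ← mul_add,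
    mul_left_comm]
  gcongr
  unfold gaugeSq heisChart
  simp only [one_mul, one_pow]
  refine quasi_triangle ?_ ?_ ?_
  · nlinarith [sq_nonneg (u.1 - ai.1 - (ai.1 - aj.1))]
  · nlinarith [sq_nonneg (u.2.1 - ai.2.1 - (ai.2.1 - aj.2.1))]
  · rw [← abs_two (α := ℝ), ← abs_mul, abs_two, ← abs_neg (2 * _)]
    refine abs_le_abs_add_three ?_
    ring

lemma gaugeSq_triangle' (ai aj : ℝ × ℝ × ℝ) (l : ℝ) (u : ℝ × ℝ × ℝ) :
    gaugeSq (heisChart aj l ai)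
      ≤ 3 * (gaugeSq (heisChart ai l u) + gaugeSq (heisChart aj l u)) := by
  rw [gaugeSq_heisChart aj, gaugeSq_heisChart ai, gaugeSq_heisChart aj l u, ← mul_add,
    mul_left_comm]
  gcongr
  unfold gaugeSq heisChart
  simp only [one_mul, one_pow]
  refine quasi_triangle ?_ ?_ ?_
  · nlinarith [sq_nonneg (u.1 - ai.1 + (u.1 - aj.1))]
  · nlinarith [sq_nonneg (u.2.1 - ai.2.1 + (u.2.1 - aj.2.1))]
  · rw [← abs_two (α := ℝ), ← abs_mul, abs_two, ← abs_neg (u.2.2 - ai.2.2 + _)]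
    refine abs_le_abs_add_three ?_
    ring

lemma rpow_neg_le_of_le_mul {α k X Y : ℝ} (hα : 0 ≤ α) (hα2 : α ≤ 2) (hk : 1 ≤ k) (hX : 0 < X)
    (hY : 0 < Y) (h : X ≤ k * Y) : Y ^ (-α) ≤ k ^ 2 * X ^ (-α) := by
  have h1 : (k * Y) ^ (-α) ≤ X ^ (-α) := Real.rpow_le_rpow_of_nonpos hX h (by linarith)
  have hk0 : 0 < k := by linarith
  rw [Real.mul_rpow hk0.le hY.le] at h1
  have h2 : k ^ α ≤ k ^ 2 := by
    rw [← Real.rpow_two]; exact Real.rpow_le_rpow_of_exponent_le hk hα2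
  have h3 : k ^ α * k ^ (-α) = 1 := by rw [← Real.rpow_add hk0]; simp
  calc Y ^ (-α) = k ^ α * (k ^ (-α) * Y ^ (-α)) := by rw [← mul_assoc, h3, one_mul]
    _ ≤ k ^ 2 * X ^ (-α) := by gcongr

lemma bubble_bounds {γ c₀ : ℝ} (h0 : 0 < γ) (h1 : γ < 1) (hc : 0 < c₀) (a : ℝ × ℝ × ℝ) {l : ℝ}
    (hl : 0 < l) (u : ℝ × ℝ × ℝ) :
    c₀ * l ^ (2 - γ) * (1 + gaugeSq (heisChart a l u)) ^ (-(2 - γ)) ≤ bubble γ c₀ a l u ∧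
      bubble γ c₀ a l u ≤
        2 * c₀ * l ^ (2 - γ) * (1 + gaugeSq (heisChart a l u)) ^ (-(2 - γ)) := by
  set q := gaugeSq (heisChart a l u) with hq
  have hq0 : 0 ≤ q := gaugeSq_nonneg _
  set X := (1 + l ^ 2 * ((u.1 - a.1) ^ 2 + (u.2.1 - a.2.1) ^ 2)) ^ 2
        + l ^ 4 * (u.2.2 - a.2.2 + 2 * (a.1 * u.2.1 - u.1 * a.2.1)) ^ 2 with hX
  have hb : bubble γ c₀ a l u = c₀ * l ^ (2 - γ) * X ^ (-(2 - γ) / 2) := rfl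
  set A := l ^ 2 * ((u.1 - a.1) ^ 2 + (u.2.1 - a.2.1) ^ 2) with hA
  set t := l ^ 2 * |u.2.2 - a.2.2 + 2 * (a.1 * u.2.1 - u.1 * a.2.1)| with ht
  have hqe : q = A + t := by
    rw [hq, gaugeSq_heisChart, hA, ht]; simp [gaugeSq, heisChart]; ring
  have hXe : X = (1 + A) ^ 2 + t ^ 2 := by rw [hX, ht, mul_pow, sq_abs]; ring
  have hA0 : 0 ≤ A := by positivity
  have ht0 : 0 ≤ t := by positivity
  have hX0 : 0 < X := by rw [hXe]; positivity
  have hXu : X ≤ (1 + q) ^ 2 := by rw [hXe, hqe]; nlinarith [mul_nonneg hA0 ht0]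
  have hXl : (1 + q) ^ 2 ≤ 2 * X := by rw [hXe, hqe]; nlinarith [sq_nonneg (1 + A - t)]
  have hpow : ((1 + q) ^ 2) ^ (-(2 - γ) / 2) = (1 + q) ^ (-(2 - γ)) := by
    rw [← Real.rpow_two, ← Real.rpow_mul (by positivity)]; congr 1; ring
  have hlow : (1 + q) ^ (-(2 - γ)) ≤ X ^ (-(2 - γ) / 2) := by
    rw [← hpow]; exact Real.rpow_le_rpow_of_nonpos hX0 hXu (by linarith)
  have hup : X ^ (-(2 - γ) / 2) ≤ 2 * (1 + q) ^ (-(2 - γ)) := by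
    have h2 : ((1 + q) ^ 2 / 2) ^ (-(2 - γ) / 2) ≥ X ^ (-(2 - γ) / 2) :=
      Real.rpow_le_rpow_of_nonpos (by positivity) (by linarith) (by linarith)
    refine h2.le.trans ?_
    rw [Real.div_rpow (by positivity) (by positivity), hpow, neg_div, Real.rpow_neg (x := 2) (by positivity),
      div_inv_eq_mul, mul_comm]
    gcongr
    calc (2 : ℝ) ^ ((2 - γ) / 2) ≤ 2 ^ (1 : ℝ) :=
          Real.rpow_le_rpow_of_exponent_le (by norm_num) (by linarith)
      _ = 2 := Real.rpow_one 2
  rw [hb]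
  constructor
  · gcongr
  · calc c₀ * l ^ (2 - γ) * X ^ (-(2 - γ) / 2)
        ≤ c₀ * l ^ (2 - γ) * (2 * (1 + q) ^ (-(2 - γ))) := by gcongr
      _ = _ := by ring

lemma epsb_bounds {γ : ℝ} (h0 : 0 < γ) (h1 : γ < 1) (ai aj : ℝ × ℝ × ℝ) {li lj : ℝ}
    (hi : 0 < li) (hj : 0 < lj) :
    (lj / li + (lj / li)⁻¹ + lj / li * gaugeSq (heisChart aj li ai)) ^ (-(2 - γ))
        ≤ epsb γ ai aj li lj ∧
      epsb γ ai aj li lj ≤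
        4 * (lj / li + (lj / li)⁻¹ + lj / li * gaugeSq (heisChart aj li ai)) ^ (-(2 - γ)) := by
  set g := gaugeSq (heisChart aj 1 ai) with hg
  have hg0 : 0 ≤ g := gaugeSq_nonneg _
  rw [gaugeSq_heisChart aj li ai, ← hg]
  set r := (ai.1 - aj.1) ^ 2 + (ai.2.1 - aj.2.1) ^ 2 with hr
  set τ := ai.2.2 - aj.2.2 + 2 * aj.1 * ai.2.1 - 2 * ai.1 * aj.2.1 with hτ
  have hr0 : 0 ≤ r := by positivity
  have hgr : g = r + |τ| := by
    rw [hg, hr, hτ]; simp only [gaugeSq, heisChart, one_mul, one_pow]; congr 2; ring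
  have hd : gdist ai aj ^ 2 = √(r ^ 2 + τ ^ 2) := by
    rw [Real.sqrt_eq_rpow, gdist, ← hr, ← hτ, ← Real.rpow_two, ← Real.rpow_mul (by positivity)]
    norm_num
  have hdu : √(r ^ 2 + τ ^ 2) ≤ g := by
    refine Real.sqrt_le_iff.2 ⟨hg0, ?_⟩
    rw [hgr, ← sq_abs τ]; nlinarith [mul_nonneg hr0 (abs_nonneg τ)]
  have hdl : g ≤ 2 * √(r ^ 2 + τ ^ 2) := by
    have : g / 2 ≤ √(r ^ 2 + τ ^ 2) := by
      refine Real.le_sqrt_of_sq_le ?_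
      rw [hgr, ← sq_abs τ]; nlinarith [sq_nonneg (r - |τ|), sq_nonneg r, sq_nonneg |τ|]
    linarith
  have hE : li / lj + lj / li + li * lj * gdist ai aj ^ 2
      = lj / li + (lj / li)⁻¹ + lj / li * (li ^ 2 * √(r ^ 2 + τ ^ 2)) := by
    rw [hd]; field_simp; ring
  rw [epsb, hE]
  constructor
  · refine Real.rpow_le_rpow_of_nonpos (by positivity) ?_ (by linarith)
    gcongr
  · have h := rpow_neg_le_of_le_mul (α := 2 - γ) (k := 2)
      (X := lj / li + (lj / li)⁻¹ + lj / li * (li ^ 2 * g))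
      (Y := lj / li + (lj / li)⁻¹ + lj / li * (li ^ 2 * √(r ^ 2 + τ ^ 2)))
      (by linarith) (by linarith) (by norm_num) (by positivity) (by positivity) (by
        have : lj / li * (li ^ 2 * g) ≤ lj / li * (li ^ 2 * (2 * √(r ^ 2 + τ ^ 2))) := by gcongr
        have : 0 < lj / li + (lj / li)⁻¹ := by positivity
        linarith)
    norm_num at h ⊢
    exact h

lemma scaled_product_le {γ P Q B l : ℝ} (h0 : 0 < γ) (h1 : γ < 1) (hP : 0 < P) (hQ : 0 < Q)
    (hB : 0 ≤ B) (hl : 0 < l) (h : B ≤ 3 * (P + Q)) :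
    (1 + P) ^ (-(2 + γ)) * (l⁻¹ + l * Q) ^ (-(2 - γ)) ≤
      49 * (l + l⁻¹ + l * B) ^ (-(2 - γ)) *
        (min (P ^ (-(2 - γ))) (P ^ (-(2 + γ))) + min (Q ^ (-(2 - γ))) (Q ^ (-(2 + γ)))) := by
  have hl' : 0 < l⁻¹ := by positivity
  set D := l + l⁻¹ + l * B with hD
  have hD0 : 0 < D := by positivity
  have hlB : l * B ≤ l * (3 * (P + Q)) := by gcongr
  rcases le_or_gt (1 + P) Q with hPQ | hPQ
  · have hG : (l⁻¹ + l * Q) ^ (-(2 - γ)) ≤ 7 ^ 2 * D ^ (-(2 - γ)) := by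
      refine rpow_neg_le_of_le_mul (by linarith) (by linarith) (by norm_num) hD0 (by positivity) ?_
      have := mul_le_mul_of_nonneg_left hPQ hl.le
      nlinarith [mul_pos hl hP, mul_pos hl hQ]
    have hp : (1 + P) ^ (-(2 + γ)) ≤ min (P ^ (-(2 - γ))) (P ^ (-(2 + γ))) := by
      refine le_min ?_ (Real.rpow_le_rpow_of_nonpos hP (by linarith) (by linarith))
      exact (Real.rpow_le_rpow_of_exponent_le (by linarith) (by linarith)).trans
        (Real.rpow_le_rpow_of_nonpos hP (by linarith) (by linarith))
    calc _ ≤ min (P ^ (-(2 - γ))) (P ^ (-(2 + γ))) * (7 ^ 2 * D ^ (-(2 - γ))) := by gcongr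
      _ = 49 * D ^ (-(2 - γ)) * (min (P ^ (-(2 - γ))) (P ^ (-(2 + γ))) + 0) := by ring
      _ ≤ _ := by gcongr; positivity
  · have hG : (l⁻¹ + l * Q) ^ (-(2 - γ)) ≤ 7 ^ 2 * (D * (Q / (1 + P))) ^ (-(2 - γ)) := by
      refine rpow_neg_le_of_le_mul (by linarith) (by linarith) (by norm_num) (by positivity)
        (by positivity) ?_
      rw [mul_div_assoc', div_le_iff₀ (by positivity)]
      have e1 : l⁻¹ * Q ≤ l⁻¹ * (1 + P) := by gcongr
      have e2 : l * Q * Q ≤ l * Q * (1 + P) := by gcongr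
      have e3 : l * B * Q ≤ l * (3 * (P + Q)) * Q := by gcongr
      have e4 : 0 < l * Q * P := by positivity
      have e5 : 0 < l * Q := by positivity
      have e6 : 0 < l⁻¹ * (1 + P) := by positivity
      rw [hD]
      nlinarith
    have hp : (1 + P) ^ (-(2 * γ)) * Q ^ (-(2 - γ)) ≤
        min (Q ^ (-(2 - γ))) (Q ^ (-(2 + γ))) := by
      refine le_min ?_ ?_
      · refine mul_le_of_le_one_left (by positivity) ?_
        exact Real.rpow_le_one_of_one_le_of_nonpos (by linarith) (by linarith)
      · calc _ ≤ Q ^ (-(2 * γ)) * Q ^ (-(2 - γ)) := by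
              gcongr ?_ * _
              exact Real.rpow_le_rpow_of_nonpos hQ hPQ.le (by linarith)
          _ = _ := by rw [← Real.rpow_add hQ]; congr 1; ring
    have he : (D * (Q / (1 + P))) ^ (-(2 - γ))
        = D ^ (-(2 - γ)) * (Q ^ (-(2 - γ)) * (1 + P) ^ (2 - γ)) := by
      rw [Real.mul_rpow (by positivity) (by positivity), Real.div_rpow (by positivity)
        (by positivity), Real.rpow_neg (x := 1 + P) (by positivity), div_inv_eq_mul]
    have hs : (1 + P) ^ (-(2 + γ)) * (1 + P) ^ (2 - γ) = (1 + P) ^ (-(2 * γ)) := by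
      rw [← Real.rpow_add (by positivity)]; congr 1; ring
    calc _ ≤ (1 + P) ^ (-(2 + γ)) * (7 ^ 2 * (D * (Q / (1 + P))) ^ (-(2 - γ))) := by gcongr
      _ = 49 * D ^ (-(2 - γ)) * (0 + (1 + P) ^ (-(2 * γ)) * Q ^ (-(2 - γ))) := by
        rw [he, ← hs]; ring
      _ ≤ _ := by gcongr; positivity

lemma le_scaled_product {γ P Q B l : ℝ} (h0 : 0 < γ) (h1 : γ < 1) (hP : 0 ≤ P) (hP3 : P ≤ 3)
    (hQ : 0 ≤ Q) (hB : 0 ≤ B) (hl : 0 < l) (h : Q ≤ 3 * (P + B)) :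
    (l + l⁻¹ + l * B) ^ (-(2 - γ)) ≤
      5184 * ((1 + P) ^ (-(2 + γ)) * (l⁻¹ + l * Q) ^ (-(2 - γ))) := by
  have hl' : 0 < l⁻¹ := by positivity
  have hG : (l + l⁻¹ + l * B) ^ (-(2 - γ)) ≤ 9 ^ 2 * (l⁻¹ + l * Q) ^ (-(2 - γ)) := by
    refine rpow_neg_le_of_le_mul (by linarith) (by linarith) (by norm_num) (by positivity)
      (by positivity) ?_
    have : l * Q ≤ l * (3 * (3 + B)) := by gcongr; linarith
    nlinarith [mul_nonneg hl.le hB]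
  have hp : 1 ≤ 64 * (1 + P) ^ (-(2 + γ)) := by
    have e1 : (4 : ℝ) ^ (-(3 : ℝ)) ≤ (1 + P) ^ (-(2 + γ)) :=
      (Real.rpow_le_rpow_of_nonpos (by positivity) (by linarith) (by norm_num)).trans
        (Real.rpow_le_rpow_of_exponent_le (by linarith) (by linarith))
    have e2 : (4 : ℝ) ^ (-(3 : ℝ)) = 1 / 64 := by
      rw [Real.rpow_neg (by norm_num)]; norm_num
    rw [e2] at e1
    linarith
  calc _ ≤ 1 * (9 ^ 2 * (l⁻¹ + l * Q) ^ (-(2 - γ))) := by rw [one_mul]; exact hG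
    _ ≤ 64 * (1 + P) ^ (-(2 + γ)) * (9 ^ 2 * (l⁻¹ + l * Q) ^ (-(2 - γ))) := by gcongr
    _ = _ := by ring

/-- The product of the two model profiles, written in the scale of the first one. -/
lemma scaled_product_eq {γ κ κ' P Q li lj : ℝ} (h0 : 0 < γ) (h1 : γ < 1) (hκ : 0 < κ) (hP : 0 ≤ P)
    (hQ : 0 ≤ Q) (hi : 0 < li) (hj : 0 < lj) :
    (κ * li ^ (2 - γ) * (1 + P) ^ (-(2 - γ))) ^ ((2 + γ) / (2 - γ)) *
        (κ' * lj ^ (2 - γ) * (1 + (lj / li) ^ 2 * Q) ^ (-(2 - γ))) =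
      κ ^ ((2 + γ) / (2 - γ)) * κ' * li ^ 4 *
        ((1 + P) ^ (-(2 + γ)) * ((lj / li)⁻¹ + lj / li * Q) ^ (-(2 - γ))) := by
  have hne : (2 - γ) ≠ 0 := by linarith
  have e1 : (κ * li ^ (2 - γ) * (1 + P) ^ (-(2 - γ))) ^ ((2 + γ) / (2 - γ))
      = κ ^ ((2 + γ) / (2 - γ)) * li ^ (2 + γ) * (1 + P) ^ (-(2 + γ)) := by
    rw [Real.mul_rpow (by positivity) (by positivity), Real.mul_rpow (by positivity)
      (by positivity), ← Real.rpow_mul hi.le, ← Real.rpow_mul (by positivity)]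
    congr 2
    · congr 1; field_simp
    · field_simp
  have e2 : (1 + (lj / li) ^ 2 * Q) = (lj / li) * ((lj / li)⁻¹ + lj / li * Q) := by
    field_simp
  have e3 : lj ^ (2 - γ) * (lj / li) ^ (-(2 - γ)) = li ^ (2 - γ) := by
    rw [Real.rpow_neg (by positivity), Real.div_rpow hj.le hi.le]
    have := Real.rpow_pos_of_pos hj (2 - γ)
    have := Real.rpow_pos_of_pos hi (2 - γ)
    field_simp
  have e4 : li ^ (2 + γ) * li ^ (2 - γ) = li ^ 4 := by
    rw [← Real.rpow_add hi, ← Real.rpow_natCast]; congr 1; norm_num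
  rw [e1, e2, Real.mul_rpow (by positivity) (by positivity), ← e4, ← e3]
  ring

lemma gaugeSq_heisChart_rescale (a : ℝ × ℝ × ℝ) {li lj : ℝ} (hi : 0 < li) (u : ℝ × ℝ × ℝ) :
    gaugeSq (heisChart a lj u) = (lj / li) ^ 2 * gaugeSq (heisChart a li u) := by
  rw [gaugeSq_heisChart a lj, gaugeSq_heisChart a li]
  field_simp

lemma bubble_nonneg {γ c₀ : ℝ} (hc : 0 < c₀) (a : ℝ × ℝ × ℝ) {l : ℝ} (hl : 0 < l)
    (u : ℝ × ℝ × ℝ) : 0 ≤ bubble γ c₀ a l u := by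
  unfold bubble; positivity

lemma gaugeSq_pos {w : ℝ × ℝ × ℝ} (hw : w.1 ≠ 0) : 0 < gaugeSq w := by
  unfold gaugeSq; positivity

lemma interaction_le {γ c₀ : ℝ} (h0 : 0 < γ) (h1 : γ < 1) (hc : 0 < c₀) (ai aj : ℝ × ℝ × ℝ)
    {li lj : ℝ} (hi : 0 < li) (hj : 0 < lj) {u : ℝ × ℝ × ℝ}
    (hui : (heisChart ai li u).1 ≠ 0 ∧ (heisChart ai li u).2.1 ≠ 0 ∧ (heisChart ai li u).2.2 ≠ 0)
    (huj : (heisChart aj li u).1 ≠ 0 ∧ (heisChart aj li u).2.1 ≠ 0 ∧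
      (heisChart aj li u).2.2 ≠ 0) :
    bubble γ c₀ ai li u ^ ((2 + γ) / (2 - γ)) * bubble γ c₀ aj lj u ≤
      (2 * c₀) ^ ((2 + γ) / (2 - γ)) * (2 * c₀) * 49 * epsb γ ai aj li lj * li ^ 4 *
        (prodProfile γ (heisChart ai li u) + prodProfile γ (heisChart aj li u)) := by
  have hP := gaugeSq_pos hui.1
  have hQ := gaugeSq_pos huj.1
  have hB := gaugeSq_nonneg (heisChart aj li ai)
  have hl : 0 < lj / li := by positivity
  have hbi := (bubble_bounds h0 h1 hc ai hi u).2
  have hbj := (bubble_bounds h0 h1 hc aj hj u).2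
  rw [gaugeSq_heisChart_rescale aj hi] at hbj
  have hS := scaled_product_le h0 h1 hP hQ hB hl (gaugeSq_triangle' ai aj li u)
  have hE := (epsb_bounds h0 h1 ai aj hi hj).1
  have hpi := min_rpow_le_prodProfile h0 h1 hui
  have hpj := min_rpow_le_prodProfile h0 h1 huj
  have n0 := bubble_nonneg (γ := γ) hc ai hi u
  have n1 := bubble_nonneg (γ := γ) hc aj hj u
  have hexp : 0 ≤ (2 + γ) / (2 - γ) := div_nonneg (by linarith) (by linarith)
  have n2 : 0 ≤ epsb γ ai aj li lj := le_trans (by positivity) hE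
  have n3 := prodProfile_nonneg γ (heisChart ai li u)
  have hmul := mul_le_mul (Real.rpow_le_rpow n0 hbi hexp) hbj n1 (by positivity)
  rw [scaled_product_eq h0 h1 (by positivity) hP.le hQ.le hi hj] at hmul
  refine hmul.trans ?_
  calc _ ≤ (2 * c₀) ^ ((2 + γ) / (2 - γ)) * (2 * c₀) * li ^ 4 *
        (49 * epsb γ ai aj li lj *
          (prodProfile γ (heisChart ai li u) + prodProfile γ (heisChart aj li u))) := by
        refine mul_le_mul_of_nonneg_left (hS.trans ?_) (by positivity)
        gcongr
    _ = _ := by ring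

lemma le_interaction {γ c₀ : ℝ} (h0 : 0 < γ) (h1 : γ < 1) (hc : 0 < c₀) (ai aj : ℝ × ℝ × ℝ)
    {li lj : ℝ} (hi : 0 < li) (hj : 0 < lj) {u : ℝ × ℝ × ℝ}
    (hu : gaugeSq (heisChart ai li u) ≤ 3) :
    c₀ ^ ((2 + γ) / (2 - γ)) * c₀ / 20736 * epsb γ ai aj li lj * li ^ 4 ≤
      bubble γ c₀ ai li u ^ ((2 + γ) / (2 - γ)) * bubble γ c₀ aj lj u := by
  have hP := gaugeSq_nonneg (heisChart ai li u)
  have hQ := gaugeSq_nonneg (heisChart aj li u)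
  have hB := gaugeSq_nonneg (heisChart aj li ai)
  have hl : 0 < lj / li := by positivity
  have hbi := (bubble_bounds h0 h1 hc ai hi u).1
  have hbj := (bubble_bounds h0 h1 hc aj hj u).1
  rw [gaugeSq_heisChart_rescale aj hi] at hbj
  have hS := le_scaled_product h0 h1 hP hu hQ hB hl (gaugeSq_triangle ai aj li u)
  have hE := (epsb_bounds h0 h1 ai aj hi hj).2
  have n0 := bubble_nonneg (γ := γ) hc ai hi u
  have hexp : 0 ≤ (2 + γ) / (2 - γ) := div_nonneg (by linarith) (by linarith)
  have hmul := mul_le_mul (Real.rpow_le_rpow (by positivity) hbi hexp) hbj (by positivity)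
    (by positivity)
  rw [scaled_product_eq h0 h1 hc hP hQ hi hj] at hmul
  refine le_trans ?_ hmul
  have hT := hE.trans (mul_le_mul_of_nonneg_left hS (by norm_num))
  have hk : 0 ≤ c₀ ^ ((2 + γ) / (2 - γ)) * c₀ * li ^ 4 / 20736 := by positivity
  have := mul_le_mul_of_nonneg_left hT hk
  linarith

lemma continuous_bubble {γ c₀ : ℝ} (a : ℝ × ℝ × ℝ) {l : ℝ} :
    Continuous (bubble γ c₀ a l) := by
  unfold bubble
  refine continuous_const.mul (Continuous.rpow_const (by fun_prop) fun u => Or.inl ?_)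
  positivity

lemma volume_unitCube : volume (Set.Icc (0 : ℝ × ℝ × ℝ) 1) = 1 := by
  have h1 : Set.Icc (0 : ℝ × ℝ × ℝ) 1 =
      Set.Icc (0 : ℝ) 1 ×ˢ (Set.Icc (0 : ℝ) 1 ×ˢ Set.Icc (0 : ℝ) 1) := by
    rw [Set.Icc_prod_Icc, Set.Icc_prod_Icc]; rfl
  rw [h1, Measure.volume_eq_prod, Measure.prod_prod, Measure.volume_eq_prod, Measure.prod_prod]
  simp

lemma gaugeSq_le_of_mem_unitCube {w : ℝ × ℝ × ℝ} (hw : w ∈ Set.Icc (0 : ℝ × ℝ × ℝ) 1) :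
    gaugeSq w ≤ 3 := by
  obtain ⟨⟨a1, a2, a3⟩, b1, b2, b3⟩ := hw
  simp only [Prod.fst_zero, Prod.snd_zero, Prod.fst_one, Prod.snd_one] at a1 a2 a3 b1 b2 b3
  rw [gaugeSq, abs_of_nonneg a3]
  nlinarith

/-- Lemma A.2: two-sided estimate `∫ δ_i^{(2+γ)/(2−γ)} δ_j = O'(ε_ij)`. -/
theorem bubble_interaction_two_sided (γ : ℝ) (hγ : γ ∈ Set.Ioo (0 : ℝ) 1)
    (c₀ : ℝ) (hc₀ : 0 < c₀) :
    ∃ ε₀ ∈ Set.Ioo (0 : ℝ) 1, ∃ C₁ C₂ : ℝ, 0 < C₁ ∧ C₁ ≤ C₂ ∧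
      ∀ (ai aj : ℝ × ℝ × ℝ) (li lj : ℝ), 0 < li → 0 < lj →
        epsb γ ai aj li lj ≤ ε₀ →
          C₁ * epsb γ ai aj li lj ≤
              (∫ u : ℝ × ℝ × ℝ,
                bubble γ c₀ ai li u ^ ((2 + γ) / (2 - γ)) * bubble γ c₀ aj lj u) ∧
            (∫ u : ℝ × ℝ × ℝ,
                bubble γ c₀ ai li u ^ ((2 + γ) / (2 - γ)) * bubble γ c₀ aj lj u)
              ≤ C₂ * epsb γ ai aj li lj := by
  obtain ⟨h0, h1⟩ := hγ
  set C₁ := c₀ ^ ((2 + γ) / (2 - γ)) * c₀ / 20736 with hC₁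
  set M := (2 * c₀) ^ ((2 + γ) / (2 - γ)) * (2 * c₀) * 49 with hM
  set J := ∫ w, prodProfile γ w with hJ
  have hprof := integrable_prodProfile h0
  refine ⟨1 / 2, by norm_num, C₁, max C₁ (M * (2 * J)), by positivity, le_max_left _ _, ?_⟩
  intro ai aj li lj hi hj _
  set E := epsb γ ai aj li lj with hE
  have hE0 : 0 ≤ E := by rw [hE, epsb]; positivity
  set f : ℝ × ℝ × ℝ → ℝ := fun u =>
    bubble γ c₀ ai li u ^ ((2 + γ) / (2 - γ)) * bubble γ c₀ aj lj u with hf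
  have hexp : 0 ≤ (2 + γ) / (2 - γ) := div_nonneg (by linarith) (by linarith)
  have hf0 : ∀ u, 0 ≤ f u := fun u =>
    mul_nonneg (Real.rpow_nonneg (bubble_nonneg hc₀ ai hi u) _) (bubble_nonneg hc₀ aj hj u)
  have hfc : Continuous f :=
    ((continuous_bubble ai).rpow_const fun _ => Or.inr hexp).mul (continuous_bubble aj)
  have hgi := integrable_comp_heisChart ai hi hprof
  have hgj := integrable_comp_heisChart aj hi hprof
  have hle : ∀ᵐ u, f u ≤ M * E * li ^ 4 *
      (prodProfile γ (heisChart ai li u) + prodProfile γ (heisChart aj li u)) := by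
    filter_upwards [ae_heisChart_ne_zero ai hi, ae_heisChart_ne_zero aj hi] with u hui huj
    exact interaction_le h0 h1 hc₀ ai aj hi hj hui huj
  have hg := (hgi.add hgj).const_mul (M * E * li ^ 4)
  have hfi : Integrable f := by
    refine hg.mono' hfc.aestronglyMeasurable ?_
    filter_upwards [hle] with u hu
    rw [Real.norm_of_nonneg (hf0 u)]
    exact hu
  constructor
  · have hcube : Integrable ((Set.Icc (0 : ℝ × ℝ × ℝ) 1).indicator fun _ => (1 : ℝ)) :=
      (integrable_indicator_iff measurableSet_Icc).2
        (integrableOn_const (by rw [volume_unitCube]; simp))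
    have hint : ∫ u, C₁ * E * li ^ 4 *
        (Set.Icc (0 : ℝ × ℝ × ℝ) 1).indicator (fun _ => (1 : ℝ)) (heisChart ai li u)
          = C₁ * E := by
      rw [integral_const_mul, integral_comp_heisChart ai hi hcube,
        integral_indicator measurableSet_Icc, setIntegral_const, measureReal_def, volume_unitCube]
      simp only [ENNReal.toReal_one, smul_eq_mul, mul_one]
      field_simp
    rw [← hint]
    refine integral_mono ((integrable_comp_heisChart ai hi hcube).const_mul _) hfi fun u => ?_
    by_cases hu : heisChart ai li u ∈ Set.Icc (0 : ℝ × ℝ × ℝ) 1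
    · simp only [Set.indicator_of_mem hu, mul_one]
      exact le_interaction h0 h1 hc₀ ai aj hi hj (gaugeSq_le_of_mem_unitCube hu)
    · simp only [Set.indicator_of_notMem hu, mul_zero]
      exact hf0 u
  · calc ∫ u, f u ≤ ∫ u, M * E * li ^ 4 *
          (prodProfile γ (heisChart ai li u) + prodProfile γ (heisChart aj li u)) :=
          integral_mono_ae hfi hg hle
      _ = M * (2 * J) * E := by
        rw [integral_const_mul, integral_add hgi hgj, integral_comp_heisChart ai hi hprof,
          integral_comp_heisChart aj hi hprof]
        field_simp
        ring
      _ ≤ max C₁ (M * (2 * J)) * E := by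
        gcongr
        exact le_max_right _ _
end

section
/- There exist constants ε₀ ∈ (0,1) and C > 0 (depending only on γ and c₀) such that for all a_i, a_j ∈ ℝ³ and λ_i, λ_j > 0 with ε_ij ≤ ε₀, ∫_{ℝ³} δ_{a_i,λ_i}(u)^{2/(2−γ)} · δ_{a_j,λ_j}(u)^{2/(2−γ)} du ≤ C·ε_ij^{2/(2−γ)}·log(1/ε_ij). -/
open MeasureTheory Real

theorem lintegral_inv_sq_add_sq {a : ℝ} (ha : 0 < a) (c : ℝ) :
    ∫⁻ t : ℝ, ENNReal.ofReal ((a ^ 2 + (t + c) ^ 2)⁻¹) = ENNReal.ofReal (π / a) := by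
  have h : ∀ t : ℝ, (a ^ 2 + t ^ 2)⁻¹ = (a ^ 2)⁻¹ * (1 + (t / a) ^ 2)⁻¹ := by
    intro t
    field_simp
  rw [lintegral_add_right_eq_self (fun t : ℝ => ENNReal.ofReal ((a ^ 2 + t ^ 2)⁻¹)) c,
    ← ofReal_integral_eq_lintegral_ofReal]
  · simp_rw [h]
    rw [integral_const_mul, Measure.integral_comp_div (fun t : ℝ => (1 + t ^ 2)⁻¹) a,
      integral_univ_inv_one_add_sq, abs_of_pos ha, smul_eq_mul]
    congr 1
    field_simp
  · simp_rw [h]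
    exact (integrable_inv_one_add_sq.comp_div ha.ne').const_mul _
  · exact Filter.Eventually.of_forall fun t => by positivity

theorem hasDerivAt_log_radial {m S : ℝ} (hm : 0 < m) (hS : 0 < S) (r : ℝ) :
    HasDerivAt (fun r : ℝ => -((4 * S ^ 2)⁻¹ * log (1 + S ^ 2 / (m ^ 2 + r ^ 2) ^ 2)))
      (r * ((m ^ 2 + r ^ 2) * (S ^ 2 + (m ^ 2 + r ^ 2) ^ 2))⁻¹) r := by
  have hA : 0 < m ^ 2 + r ^ 2 := by positivity
  have h1 : HasDerivAt (fun r : ℝ => (m ^ 2 + r ^ 2) ^ 2) (2 * (m ^ 2 + r ^ 2) * (2 * r)) r := by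
    simpa using ((hasDerivAt_pow 2 r).const_add (m ^ 2)).fun_pow 2
  have hne : 1 + S ^ 2 / (m ^ 2 + r ^ 2) ^ 2 ≠ 0 := by positivity
  have h2 := (((hasDerivAt_const r (S ^ 2)).fun_div h1 (by positivity)).const_add 1).log hne
  refine (h2.const_mul ((4 * S ^ 2)⁻¹)).fun_neg.congr_deriv ?_
  field_simp
  ring

theorem lintegral_radial {m S : ℝ} (hm : 0 < m) (hS : 0 < S) :
    ∫⁻ r in Set.Ioi (0 : ℝ),
        ENNReal.ofReal (r * ((m ^ 2 + r ^ 2) * (S ^ 2 + (m ^ 2 + r ^ 2) ^ 2))⁻¹) =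
      ENNReal.ofReal ((4 * S ^ 2)⁻¹ * log (1 + S ^ 2 / m ^ 4)) := by
  have hd := hasDerivAt_log_radial hm hS
  have hpos : ∀ r ∈ Set.Ioi (0 : ℝ),
      0 ≤ r * ((m ^ 2 + r ^ 2) * (S ^ 2 + (m ^ 2 + r ^ 2) ^ 2))⁻¹ := by
    intro r hr
    have : 0 < r := hr
    positivity
  have hlim : Filter.Tendsto
      (fun r : ℝ => -((4 * S ^ 2)⁻¹ * log (1 + S ^ 2 / (m ^ 2 + r ^ 2) ^ 2)))
      Filter.atTop (nhds 0) := by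
    have h1 : Filter.Tendsto (fun r : ℝ => (m ^ 2 + r ^ 2) ^ 2) Filter.atTop Filter.atTop :=
      (Filter.tendsto_pow_atTop two_ne_zero).comp
        (Filter.tendsto_atTop_add_const_left _ _ (Filter.tendsto_pow_atTop two_ne_zero))
    have h2 := ((h1.const_div_atTop (S ^ 2)).const_add 1).log (by norm_num)
    simpa only [add_zero, log_one, mul_zero, neg_zero] using (h2.const_mul ((4 * S ^ 2)⁻¹)).neg
  rw [← ofReal_integral_eq_lintegral_ofReal]
  · rw [integral_Ioi_of_hasDerivAt_of_nonneg' (fun r _ => hd r) hpos hlim]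
    congr 1
    norm_num [← pow_mul]
  · exact integrableOn_Ioi_deriv_of_nonneg' (fun r _ => hd r) hpos hlim
  · exact (ae_restrict_iff' measurableSet_Ioi).2 (Filter.Eventually.of_forall hpos)

theorem lintegral_planar {m S : ℝ} (hm : 0 < m) (hS : 0 < S) :
    ∫⁻ p : ℝ × ℝ, ENNReal.ofReal
        (((m ^ 2 + (p.1 ^ 2 + p.2 ^ 2)) * (S ^ 2 + (m ^ 2 + (p.1 ^ 2 + p.2 ^ 2)) ^ 2))⁻¹) =
      ENNReal.ofReal (π / (2 * S ^ 2) * log (1 + S ^ 2 / m ^ 4)) := by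
  rw [← lintegral_comp_polarCoord_symm, polarCoord_target, Measure.volume_eq_prod,
    setLIntegral_prod _ (by simp only [polarCoord_symm_apply]; fun_prop)]
  have h : ∀ r ∈ Set.Ioi (0 : ℝ), ∫⁻ θ in Set.Ioo (-π) π, ENNReal.ofReal r • ENNReal.ofReal
        (((m ^ 2 + ((polarCoord.symm (r, θ)).1 ^ 2 + (polarCoord.symm (r, θ)).2 ^ 2)) *
          (S ^ 2 + (m ^ 2 + ((polarCoord.symm (r, θ)).1 ^ 2 +
            (polarCoord.symm (r, θ)).2 ^ 2)) ^ 2))⁻¹) =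
      ENNReal.ofReal (r * ((m ^ 2 + r ^ 2) * (S ^ 2 + (m ^ 2 + r ^ 2) ^ 2))⁻¹) *
        ENNReal.ofReal (2 * π) := by
    intro r hr
    have hr : 0 < r := hr
    have h2 : ∀ θ : ℝ, (r * cos θ) ^ 2 + (r * sin θ) ^ 2 = r ^ 2 := by
      intro θ
      rw [mul_pow, mul_pow, ← mul_add, cos_sq_add_sin_sq, mul_one]
    simp only [polarCoord_symm_apply, h2, smul_eq_mul, lintegral_const,
      Measure.restrict_apply_univ, Real.volume_Ioo, ENNReal.ofReal_mul hr.le]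
    ring_nf
  rw [setLIntegral_congr_fun measurableSet_Ioi h, lintegral_mul_const _ (by fun_prop),
    lintegral_radial hm hS, ← ENNReal.ofReal_mul]
  · congr 1
    field_simp
    ring
  · have : 0 ≤ log (1 + S ^ 2 / m ^ 4) := log_nonneg (by simp; positivity)
    positivity

theorem lintegral_profile (a : ℝ × ℝ × ℝ) {m S : ℝ} (hm : 0 < m) (hS : 0 < S) :
    ∫⁻ u : ℝ × ℝ × ℝ, ENNReal.ofReal
        (((m ^ 2 + ((u.1 - a.1) ^ 2 + (u.2.1 - a.2.1) ^ 2)) ^ 2 +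
            (u.2.2 - a.2.2 + 2 * (a.1 * u.2.1 - u.1 * a.2.1)) ^ 2)⁻¹ *
          (S ^ 2 + (m ^ 2 + ((u.1 - a.1) ^ 2 + (u.2.1 - a.2.1) ^ 2)) ^ 2)⁻¹) =
      ENNReal.ofReal (π ^ 2 / (2 * S ^ 2) * log (1 + S ^ 2 / m ^ 4)) := by
  obtain ⟨xa, ya, ta⟩ := a
  have ht : ∀ x y : ℝ, ∫⁻ t : ℝ, ENNReal.ofReal
        (((m ^ 2 + ((x - xa) ^ 2 + (y - ya) ^ 2)) ^ 2 +
            (t - ta + 2 * (xa * y - x * ya)) ^ 2)⁻¹ *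
          (S ^ 2 + (m ^ 2 + ((x - xa) ^ 2 + (y - ya) ^ 2)) ^ 2)⁻¹) =
      ENNReal.ofReal π * ENNReal.ofReal (((m ^ 2 + ((x - xa) ^ 2 + (y - ya) ^ 2)) *
        (S ^ 2 + (m ^ 2 + ((x - xa) ^ 2 + (y - ya) ^ 2)) ^ 2))⁻¹) := by
    intro x y
    have hA : 0 < m ^ 2 + ((x - xa) ^ 2 + (y - ya) ^ 2) := by positivity
    have := lintegral_inv_sq_add_sq hA (-ta + 2 * (xa * y - x * ya))
    simp only [← add_assoc _ (-ta), ← sub_eq_add_neg] at this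
    have hB : ∀ t : ℝ, 0 ≤ ((m ^ 2 + ((x - xa) ^ 2 + (y - ya) ^ 2)) ^ 2 +
            (t - ta + 2 * (xa * y - x * ya)) ^ 2)⁻¹ := fun t => by positivity
    rw [lintegral_congr fun t => ENNReal.ofReal_mul (hB t), lintegral_mul_const _ (by fun_prop), this, ← ENNReal.ofReal_mul (by positivity),
      ← ENNReal.ofReal_mul (by positivity)]
    congr 1
    field_simp
  rw [Measure.volume_eq_prod, lintegral_prod _ (by fun_prop)]
  have hy : ∀ x : ℝ, ∫⁻ q : ℝ × ℝ, ENNReal.ofReal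
        (((m ^ 2 + ((x - xa) ^ 2 + (q.1 - ya) ^ 2)) ^ 2 +
            (q.2 - ta + 2 * (xa * q.1 - x * ya)) ^ 2)⁻¹ *
          (S ^ 2 + (m ^ 2 + ((x - xa) ^ 2 + (q.1 - ya) ^ 2)) ^ 2)⁻¹) =
      ∫⁻ y : ℝ, ENNReal.ofReal π * ENNReal.ofReal (((m ^ 2 + ((x - xa) ^ 2 + (y - ya) ^ 2)) *
        (S ^ 2 + (m ^ 2 + ((x - xa) ^ 2 + (y - ya) ^ 2)) ^ 2))⁻¹) := by
    intro x
    rw [Measure.volume_eq_prod, lintegral_prod _ (by fun_prop)]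
    exact lintegral_congr fun y => ht x y
  simp only [hy]
  rw [← lintegral_prod (fun p : ℝ × ℝ => ENNReal.ofReal π *
      ENNReal.ofReal (((m ^ 2 + ((p.1 - xa) ^ 2 + (p.2 - ya) ^ 2)) *
        (S ^ 2 + (m ^ 2 + ((p.1 - xa) ^ 2 + (p.2 - ya) ^ 2)) ^ 2))⁻¹)) (by fun_prop),
    lintegral_const_mul _ (by fun_prop), ← Measure.volume_eq_prod]
  have := lintegral_sub_right_eq_self (μ := volume) (fun p : ℝ × ℝ => ENNReal.ofReal
    (((m ^ 2 + (p.1 ^ 2 + p.2 ^ 2)) * (S ^ 2 + (m ^ 2 + (p.1 ^ 2 + p.2 ^ 2)) ^ 2))⁻¹)) (xa, ya)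
  simp only [Prod.fst_sub, Prod.snd_sub] at this
  rw [this, lintegral_planar hm hS, ← ENNReal.ofReal_mul pi_pos.le]
  congr 1
  ring

theorem sq_le_thirtytwo_mul_add (xi yi ti xj yj tj x y t m n d : ℝ)
    (hd : d ^ 2 = ((xi - xj) ^ 2 + (yi - yj) ^ 2) ^ 2 +
      (ti - tj + 2 * xj * yi - 2 * xi * yj) ^ 2) :
    (n ^ 2 + m ^ 2 + d) ^ 2 ≤ 32 *
      ((m ^ 2 + ((x - xi) ^ 2 + (y - yi) ^ 2)) ^ 2 + (t - ti + 2 * (xi * y - x * yi)) ^ 2 +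
      ((n ^ 2 + ((x - xj) ^ 2 + (y - yj) ^ 2)) ^ 2 + (t - tj + 2 * (xj * y - x * yj)) ^ 2)) := by
  obtain ⟨a, rfl⟩ : ∃ a, xi = x + a := ⟨xi - x, by ring⟩
  obtain ⟨b, rfl⟩ : ∃ b, yi = y + b := ⟨yi - y, by ring⟩
  obtain ⟨e, rfl⟩ : ∃ e, xj = x + e := ⟨xj - x, by ring⟩
  obtain ⟨f, rfl⟩ : ∃ f, yj = y + f := ⟨yj - y, by ring⟩
  obtain ⟨p, rfl⟩ : ∃ p, ti = t + 2 * ((x + a) * y - x * (y + b)) - p :=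
    ⟨t + 2 * ((x + a) * y - x * (y + b)) - ti, by ring⟩
  obtain ⟨q, rfl⟩ : ∃ q, tj = t + 2 * ((x + e) * y - x * (y + f)) - q :=
    ⟨t + 2 * ((x + e) * y - x * (y + f)) - tj, by ring⟩
  set R := a ^ 2 + b ^ 2 with hR
  set T := e ^ 2 + f ^ 2 with hT
  have hR0 : 0 ≤ R := by positivity
  have hT0 : 0 ≤ T := by positivity
  have hd' : d ^ 2 = ((a - e) ^ 2 + (b - f) ^ 2) ^ 2 + (q - p + 2 * (e * b - a * f)) ^ 2 := by
    rw [hd]; ring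
  have h1 : ((a - e) ^ 2 + (b - f) ^ 2) ^ 2 ≤ (2 * (R + T)) ^ 2 := by
    apply pow_le_pow_left₀ (by positivity)
    nlinarith [sq_nonneg (a + e), sq_nonneg (b + f)]
  have h2 : (e * b - a * f) ^ 2 ≤ R * T := by
    nlinarith [sq_nonneg (a * e + b * f)]
  have h3 : (q - p + 2 * (e * b - a * f)) ^ 2 ≤
      3 * (q ^ 2 + p ^ 2 + 4 * (e * b - a * f) ^ 2) := by
    nlinarith [sq_nonneg (q + p), sq_nonneg (q - 2 * (e * b - a * f)),
      sq_nonneg (p + 2 * (e * b - a * f))]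
  have h4 : d ^ 2 ≤ 14 * (R ^ 2 + T ^ 2) + 3 * (p ^ 2 + q ^ 2) := by
    rw [hd']
    have h0 := sq_nonneg (R - T)
    generalize ((a - e) ^ 2 + (b - f) ^ 2) ^ 2 = u at h1 ⊢
    generalize (q - p + 2 * (e * b - a * f)) ^ 2 = v at h3 ⊢
    generalize (e * b - a * f) ^ 2 = w at h2 h3
    clear hd hd' hR hT
    linarith
  have h5 : (n ^ 2 + m ^ 2 + d) ^ 2 ≤ 4 * ((m ^ 2) ^ 2 + (n ^ 2) ^ 2) + 2 * d ^ 2 := by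
    clear hd hd' h1 h2 h3 h4
    nlinarith [sq_nonneg (n ^ 2 + m ^ 2 - d), sq_nonneg (n ^ 2 - m ^ 2)]
  have h6 : (m ^ 2) ^ 2 + R ^ 2 ≤ (m ^ 2 + R) ^ 2 := by
    clear hd hd' h1 h2 h3 h4 h5
    nlinarith [mul_nonneg (sq_nonneg m) hR0]
  have h7 : (n ^ 2) ^ 2 + T ^ 2 ≤ (n ^ 2 + T) ^ 2 := by
    clear hd hd' h1 h2 h3 h4 h5
    nlinarith [mul_nonneg (sq_nonneg n) hT0]
  have h8 : (m ^ 2 + ((x - (x + a)) ^ 2 + (y - (y + b)) ^ 2)) ^ 2 = (m ^ 2 + R) ^ 2 := by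
    rw [hR]; ring
  have h9 : (n ^ 2 + ((x - (x + e)) ^ 2 + (y - (y + f)) ^ 2)) ^ 2 = (n ^ 2 + T) ^ 2 := by
    rw [hT]; ring
  have h10 : (t - (t + 2 * ((x + a) * y - x * (y + b)) - p) +
      2 * ((x + a) * y - x * (y + b))) ^ 2 = p ^ 2 := by ring
  have h11 : (t - (t + 2 * ((x + e) * y - x * (y + f)) - q) +
      2 * ((x + e) * y - x * (y + f))) ^ 2 = q ^ 2 := by ring
  rw [h8, h9, h10, h11]
  clear hd hd' h1 h2 h3 h8 h9 h10 h11 hR hT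
  linarith [sq_nonneg p, sq_nonneg q, sq_nonneg (m ^ 2), sq_nonneg (n ^ 2), sq_nonneg R,
    sq_nonneg T]

theorem inv_mul_inv_le {A B P Q S : ℝ} (hA : 0 < A) (hB : 0 < B) (hS : 0 < S)
    (hP : P ≤ A) (hQ : Q ≤ B) (hP0 : 0 < P) (hQ0 : 0 < Q) (h : S ≤ 32 * (A + B)) :
    A⁻¹ * B⁻¹ ≤ 65 * (A⁻¹ * (S + P)⁻¹ + B⁻¹ * (S + Q)⁻¹) := by
  have key : ∀ {A B P : ℝ}, 0 < A → 0 < B → 0 < P → P ≤ A → S ≤ 32 * (A + B) → A ≤ B →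
      A⁻¹ * B⁻¹ ≤ 65 * (A⁻¹ * (S + P)⁻¹) := by
    intro A B P hA hB hP0 hP h hAB
    have : B⁻¹ ≤ 65 * (S + P)⁻¹ := by
      rw [← div_eq_mul_inv, inv_eq_one_div, div_le_div_iff₀ hB (by positivity)]
      linarith
    calc A⁻¹ * B⁻¹ ≤ A⁻¹ * (65 * (S + P)⁻¹) := by gcongr
      _ = _ := by ring
  rcases le_total A B with hAB | hAB
  · have h1 := key hA hB hP0 hP h hAB
    have : 0 ≤ B⁻¹ * (S + Q)⁻¹ := by positivity
    linarith
  · have h1 := key hB hA hQ0 hQ (by linarith) hAB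
    have : 0 ≤ A⁻¹ * (S + P)⁻¹ := by positivity
    linarith

theorem bubble_rpow {γ c₀ : ℝ} (hγ : γ ∈ Set.Ioo (0 : ℝ) 1) (hc₀ : 0 < c₀)
    (a : ℝ × ℝ × ℝ) {l : ℝ} (hl : 0 < l) (u : ℝ × ℝ × ℝ) :
    bubble γ c₀ a l u ^ (2 / (2 - γ)) = c₀ ^ (2 / (2 - γ)) * (l⁻¹ ^ 2 *
      ((l⁻¹ ^ 2 + ((u.1 - a.1) ^ 2 + (u.2.1 - a.2.1) ^ 2)) ^ 2 +
        (u.2.2 - a.2.2 + 2 * (a.1 * u.2.1 - u.1 * a.2.1)) ^ 2)⁻¹) := by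
  have hg : 2 - γ ≠ 0 := by linarith [hγ.2]
  unfold bubble
  set r := (u.1 - a.1) ^ 2 + (u.2.1 - a.2.1) ^ 2 with hr
  set τ := u.2.2 - a.2.2 + 2 * (a.1 * u.2.1 - u.1 * a.2.1)
  have hr0 : 0 ≤ r := by positivity
  have hQ : 0 < (1 + l ^ 2 * r) ^ 2 + l ^ 4 * τ ^ 2 := by positivity
  rw [mul_rpow (by positivity) (by positivity), mul_rpow hc₀.le (by positivity),
    ← rpow_mul hl.le, ← rpow_mul hQ.le, show (2 - γ) * (2 / (2 - γ)) = (2 : ℕ) by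
      push_cast; field_simp,
    show -(2 - γ) / 2 * (2 / (2 - γ)) = -1 by field_simp, rpow_natCast, rpow_neg_one, mul_assoc]
  congr 1
  have : (l⁻¹ ^ 2 + r) ^ 2 + τ ^ 2 = ((1 + l ^ 2 * r) ^ 2 + l ^ 4 * τ ^ 2) / l ^ 4 := by
    field_simp
  rw [this, inv_div]
  field_simp

theorem gdist_sq_sq (ai aj : ℝ × ℝ × ℝ) :
    (gdist ai aj ^ 2) ^ 2 = ((ai.1 - aj.1) ^ 2 + (ai.2.1 - aj.2.1) ^ 2) ^ 2
      + (ai.2.2 - aj.2.2 + 2 * aj.1 * ai.2.1 - 2 * ai.1 * aj.2.1) ^ 2 := by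
  unfold gdist
  rw [← pow_mul, ← rpow_natCast, ← rpow_mul (by positivity)]
  norm_num

theorem log_one_add_pow_four_le {E x : ℝ} (hE : 2 ≤ E) (hx0 : 0 ≤ x) (hx : x ≤ E ^ 4) :
    log (1 + x) ≤ 5 * log E := by
  have h : 1 + x ≤ E ^ 5 := by
    have : 1 ≤ E ^ 4 := one_le_pow₀ (by linarith)
    nlinarith
  calc log (1 + x) ≤ log (E ^ 5) := log_le_log (by positivity) h
    _ = 5 * log E := by rw [log_pow]; norm_num

theorem integral_inv_mul_inv_le (ai aj : ℝ × ℝ × ℝ) {m n : ℝ} (hm : 0 < m) (hn : 0 < n) :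
    ∫ u : ℝ × ℝ × ℝ,
        ((m ^ 2 + ((u.1 - ai.1) ^ 2 + (u.2.1 - ai.2.1) ^ 2)) ^ 2 +
          (u.2.2 - ai.2.2 + 2 * (ai.1 * u.2.1 - u.1 * ai.2.1)) ^ 2)⁻¹ *
        ((n ^ 2 + ((u.1 - aj.1) ^ 2 + (u.2.1 - aj.2.1) ^ 2)) ^ 2 +
          (u.2.2 - aj.2.2 + 2 * (aj.1 * u.2.1 - u.1 * aj.2.1)) ^ 2)⁻¹ ≤
      65 * (π ^ 2 / (2 * (n ^ 2 + m ^ 2 + gdist ai aj ^ 2) ^ 2) *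
          log (1 + (n ^ 2 + m ^ 2 + gdist ai aj ^ 2) ^ 2 / m ^ 4) +
        π ^ 2 / (2 * (n ^ 2 + m ^ 2 + gdist ai aj ^ 2) ^ 2) *
          log (1 + (n ^ 2 + m ^ 2 + gdist ai aj ^ 2) ^ 2 / n ^ 4)) := by
  have hkey := fun u : ℝ × ℝ × ℝ => sq_le_thirtytwo_mul_add ai.1 ai.2.1 ai.2.2 aj.1 aj.2.1 aj.2.2
    u.1 u.2.1 u.2.2 m n _ (gdist_sq_sq ai aj)
  have hS : 0 < n ^ 2 + m ^ 2 + gdist ai aj ^ 2 := by positivity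
  set S := n ^ 2 + m ^ 2 + gdist ai aj ^ 2
  have hi := lintegral_profile ai hm hS
  have hj := lintegral_profile aj hn hS
  have hL : ∀ k : ℝ, 0 ≤ π ^ 2 / (2 * S ^ 2) * log (1 + S ^ 2 / k ^ 4) := by
    intro k
    have : 0 ≤ log (1 + S ^ 2 / k ^ 4) := log_nonneg (by simp; positivity)
    positivity
  have hm2 : 0 < m ^ 2 := by positivity
  have hn2 : 0 < n ^ 2 := by positivity
  rw [integral_eq_lintegral_of_nonneg_ae
    (Filter.Eventually.of_forall fun u => by positivity) (by fun_prop)]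
  refine ENNReal.toReal_le_of_le_ofReal
    (mul_nonneg (by norm_num) (add_nonneg (hL m) (hL n))) ?_
  rw [ENNReal.ofReal_mul (by norm_num), ENNReal.ofReal_add (hL m) (hL n), ← hi, ← hj,
    ← lintegral_add_left (by fun_prop), ← lintegral_const_mul _ (by fun_prop)]
  refine lintegral_mono fun u => ?_
  rw [← ENNReal.ofReal_add (by positivity) (by positivity), ← ENNReal.ofReal_mul (by norm_num)]
  apply ENNReal.ofReal_le_ofReal
  have := hkey u
  exact inv_mul_inv_le (by positivity) (by positivity) (by positivity)
    (le_add_of_nonneg_right (sq_nonneg _)) (le_add_of_nonneg_right (sq_nonneg _))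
    (by positivity) (by positivity) this

/-- Lemma A.3(1): `∫ δ_i^{2/(2−γ)} δ_j^{2/(2−γ)} = O(ε_ij^{2/(2−γ)} log(1/ε_ij))`. -/
theorem bubble_interaction_log_estimate (γ : ℝ) (hγ : γ ∈ Set.Ioo (0 : ℝ) 1)
    (c₀ : ℝ) (hc₀ : 0 < c₀) :
    ∃ ε₀ ∈ Set.Ioo (0 : ℝ) 1, ∃ C : ℝ, 0 < C ∧
      ∀ (ai aj : ℝ × ℝ × ℝ) (li lj : ℝ), 0 < li → 0 < lj →
        epsb γ ai aj li lj ≤ ε₀ →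
          (∫ u : ℝ × ℝ × ℝ,
              bubble γ c₀ ai li u ^ (2 / (2 - γ)) * bubble γ c₀ aj lj u ^ (2 / (2 - γ)))
            ≤ C * epsb γ ai aj li lj ^ (2 / (2 - γ)) * Real.log (1 / epsb γ ai aj li lj) := by
  have hg : 1 < 2 - γ := by linarith [hγ.2]
  have hg0 : 2 - γ ≠ 0 := by linarith
  refine ⟨1 / 2, by norm_num, 325 * π ^ 2 * (c₀ ^ (2 / (2 - γ))) ^ 2, by positivity, ?_⟩
  intro ai aj li lj hli hlj _
  have hm : 0 < li⁻¹ := inv_pos.2 hli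
  have hn : 0 < lj⁻¹ := inv_pos.2 hlj
  have hint := integral_inv_mul_inv_le ai aj hm hn
  obtain ⟨E, hE⟩ : ∃ E, E = li / lj + lj / li + li * lj * gdist ai aj ^ 2 := ⟨_, rfl⟩
  have heps : epsb γ ai aj li lj = E ^ (-(2 - γ)) := by rw [hE]; rfl
  have hE2 : 2 ≤ E := by
    have h1 : 2 ≤ li / lj + lj / li := by
      rw [div_add_div _ _ hlj.ne' hli.ne', le_div_iff₀ (by positivity)]
      nlinarith [sq_nonneg (li - lj)]
    have : 0 ≤ li * lj * gdist ai aj ^ 2 := by positivity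
    linarith
  have hE0 : 0 < E := by linarith
  have hSE : lj⁻¹ ^ 2 + li⁻¹ ^ 2 + gdist ai aj ^ 2 = E * (li⁻¹ * lj⁻¹) := by
    rw [hE]; field_simp
  have hSm : li⁻¹ ^ 2 ≤ E * (li⁻¹ * lj⁻¹) := by
    rw [← hSE]; nlinarith [sq_nonneg lj⁻¹, sq_nonneg (gdist ai aj)]
  have hSn : lj⁻¹ ^ 2 ≤ E * (li⁻¹ * lj⁻¹) := by
    rw [← hSE]; nlinarith [sq_nonneg li⁻¹, sq_nonneg (gdist ai aj)]
  rw [hSE] at hint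
  have hp : epsb γ ai aj li lj ^ (2 / (2 - γ)) = (E ^ 2)⁻¹ := by
    rw [heps, ← rpow_mul hE0.le, show -(2 - γ) * (2 / (2 - γ)) = -(2 : ℕ) by
      push_cast; field_simp, rpow_neg hE0.le, rpow_natCast]
  have hlog : log (1 / epsb γ ai aj li lj) = (2 - γ) * log E := by
    rw [heps, one_div, log_inv, log_rpow hE0]; ring
  have hlE : 0 ≤ log E := log_nonneg (by linarith)
  rw [hp, hlog]
  simp_rw [bubble_rpow hγ hc₀ ai hli, bubble_rpow hγ hc₀ aj hlj]
  set K := c₀ ^ (2 / (2 - γ))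
  generalize li⁻¹ = m at *
  generalize lj⁻¹ = n at *
  have hnm : n ≤ E * m := by nlinarith
  have hmn : m ≤ E * n := by nlinarith
  have hlm : log (1 + (E * (m * n)) ^ 2 / m ^ 4) ≤ 5 * log E := by
    refine log_one_add_pow_four_le hE2 (by positivity) ?_
    rw [div_le_iff₀ (by positivity)]
    calc (E * (m * n)) ^ 2 ≤ (E * (m * (E * m))) ^ 2 := by gcongr
      _ = E ^ 4 * m ^ 4 := by ring
  have hln : log (1 + (E * (m * n)) ^ 2 / n ^ 4) ≤ 5 * log E := by
    refine log_one_add_pow_four_le hE2 (by positivity) ?_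
    rw [div_le_iff₀ (by positivity)]
    calc (E * (m * n)) ^ 2 ≤ (E * ((E * n) * n)) ^ 2 := by gcongr
      _ = E ^ 4 * n ^ 4 := by ring
  simp_rw [fun A B : ℝ => show K * (m ^ 2 * A) * (K * (n ^ 2 * B)) =
    (K ^ 2 * m ^ 2 * n ^ 2) * (A * B) by ring]
  rw [integral_const_mul]
  calc _ ≤ (K ^ 2 * m ^ 2 * n ^ 2) * (65 * (π ^ 2 / (2 * (E * (m * n)) ^ 2) * (5 * log E) +
        π ^ 2 / (2 * (E * (m * n)) ^ 2) * (5 * log E))) := by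
        gcongr
        exact hint.trans (by gcongr)
    _ = 325 * π ^ 2 * K ^ 2 * (E ^ 2)⁻¹ * (1 * log E) := by
        field_simp
        ring
    _ ≤ _ := by gcongr
end

section
/- There exists ε₀ > 0 (depending only on γ) such that for all a_i, a_j ∈ ℝ³, all 0 < λ_i ≤ λ_j, and all real numbers ν_i, ν_j with ν_i ≥ 1 and ν_j ≥ 2ν_i, if ε_ij ≤ ε₀ then −( ν_i·λ_i·(∂ε_ij/∂λ_i) + ν_j·λ_j·(∂ε_ij/∂λ_j) ) ≥ ((2−γ)/2)·ε_ij. -/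
open MeasureTheory Real

/-- If `x * g' = m` at `x` and `g x > 0`, then
`x * (g ^ (-p))' = -p * g x ^ (-p) / g x * m`. -/
lemma mul_deriv_rpow_neg {g : ℝ → ℝ} {g' x m p : ℝ} (hg : HasDerivAt g g' x) (hpos : 0 < g x)
    (hm : x * g' = m) :
    x * deriv (fun l => g l ^ (-p)) x = -p * (g x ^ (-p) / g x) * m := by
  rw [(hg.rpow_const (Or.inl hpos.ne')).deriv, Real.rpow_sub_one hpos.ne', ← hm]
  ring

/-- The weighted inequality for the base `A + B + C` of the interaction quantity. -/
lemma half_sum_le_weighted {A B C νi νj : ℝ} (hA : A ≤ 1) (hC : 0 ≤ C)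
    (hS : 4 ≤ A + B + C) (hi : 1 ≤ νi) (hj : 2 * νi ≤ νj) :
    (A + B + C) / 2 ≤ νi * (A - B + C) + νj * (-A + B + C) := by
  have h₁ := mul_le_mul_of_nonneg_right hj (show 0 ≤ -A + B + C by linarith)
  have h₂ := mul_le_mul_of_nonneg_right hi (show 0 ≤ B - A + 3 * C by linarith)
  linarith

/-- The key monotonicity inequality for the pseudogradient construction:
for `0 < λ_i ≤ λ_j`, weights `ν_i ≥ 1`, `ν_j ≥ 2ν_i`, and `ε_ij` small,
`−(ν_i λ_i ∂ε_ij/∂λ_i + ν_j λ_j ∂ε_ij/∂λ_j) ≥ ((2−γ)/2) ε_ij`. -/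
theorem eps_weighted_deriv_lower_bound (γ : ℝ) (hγ : γ ∈ Set.Ioo (0 : ℝ) 1) :
    ∃ ε₀ : ℝ, 0 < ε₀ ∧
      ∀ (ai aj : ℝ × ℝ × ℝ) (li lj νi νj : ℝ), 0 < li → li ≤ lj →
        1 ≤ νi → 2 * νi ≤ νj → epsb γ ai aj li lj ≤ ε₀ →
          ((2 - γ) / 2) * epsb γ ai aj li lj ≤
            -(νi * li * deriv (fun l => epsb γ ai aj l lj) li
              + νj * lj * deriv (fun l => epsb γ ai aj li l) lj) := by
  have hp : 0 < 2 - γ := by linarith [hγ.2]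
  refine ⟨4 ^ (-(2 - γ)), by positivity, ?_⟩
  intro ai aj li lj νi νj hli hij hi hj hε
  have hlj : 0 < lj := hli.trans_le hij
  unfold epsb at hε ⊢
  generalize gdist ai aj = d at hε ⊢
  have hA : li / lj ≤ 1 := (div_le_one hlj).2 hij
  have hC : 0 ≤ li * lj * d ^ 2 := by positivity
  have hpos : 0 < li / lj + lj / li + li * lj * d ^ 2 := by positivity
  have hS : 4 ≤ li / lj + lj / li + li * lj * d ^ 2 :=
    (Real.rpow_le_rpow_iff_of_neg hpos (by norm_num) (by linarith)).1 hε
  have hderiv_i : HasDerivAt (fun l => l / lj + lj / l + l * lj * d ^ 2)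
      (1 / lj + lj * -(li ^ 2)⁻¹ + 1 * lj * d ^ 2) li :=
    (((hasDerivAt_id li).div_const lj).add ((hasDerivAt_inv hli.ne').const_mul lj)).add
      (((hasDerivAt_id li).mul_const lj).mul_const (d ^ 2))
  have hderiv_j : HasDerivAt (fun l => li / l + l / li + li * l * d ^ 2)
      (li * -(lj ^ 2)⁻¹ + 1 / li + li * 1 * d ^ 2) lj :=
    (((hasDerivAt_inv hlj.ne').const_mul li).add ((hasDerivAt_id lj).div_const li)).add
      (((hasDerivAt_id lj).const_mul li).mul_const (d ^ 2))
  have hi' := mul_deriv_rpow_neg (p := 2 - γ) (m := li / lj - lj / li + li * lj * d ^ 2)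
    hderiv_i hpos (by field_simp; ring)
  have hj' := mul_deriv_rpow_neg (p := 2 - γ) (m := -(li / lj) + lj / li + li * lj * d ^ 2)
    hderiv_j hpos (by field_simp)
  rw [mul_assoc νi, mul_assoc νj, hi', hj']
  have hkey := half_sum_le_weighted hA hC hS hi hj
  generalize li / lj = A at *
  generalize lj / li = B at *
  generalize li * lj * d ^ 2 = C at *
  have hq : 0 < (A + B + C) ^ (-(2 - γ)) / (A + B + C) := by positivity
  calc (2 - γ) / 2 * (A + B + C) ^ (-(2 - γ))
      = (2 - γ) * ((A + B + C) ^ (-(2 - γ)) / (A + B + C)) * ((A + B + C) / 2) := by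
        field_simp
    _ ≤ (2 - γ) * ((A + B + C) ^ (-(2 - γ)) / (A + B + C)) *
          (νi * (A - B + C) + νj * (-A + B + C)) := by gcongr
    _ = _ := by ring
end
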